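/- arXiv:2405.13387 — 2 statements merged into one kernel-verified Lean document; each statement's English description precedes it below -/
import Mathlib

section
/- Let ν be a compactly supported Borel probability measure on ℝ^d with supp(ν) ⊂ 𝒬 = (0,1]^d and sup_{q∈(0,1)} β_ν(q) > 0. For every r ∈ (0,+∞) the following chain holds: rF̲_r/(1−F̲_r) ≤ D̲_r(ν) ≤ rh̲_r/(1−h̲_r) ≤ rh̄_r/(1−h̄_r) = D̄_r(ν) = rq_r/(1−q_r) = rF̄_r/(1−F̄_r). -/
open MeasureTheory Filter Set Metric
open scoped ENNReal NNReal Topology Classical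

noncomputable section

/-- `ℝ^d`, modelled as `Fin d → ℝ` and carrying the maximum norm. -/
abbrev Ed (d : ℕ) := Fin d → ℝ

/-- The half-open unit cube `𝒬 = (0,1]^d`. -/
def Qcube (d : ℕ) : Set (Ed d) := {x | ∀ i, x i ∈ Set.Ioc (0:ℝ) 1}

/-- The half-open dyadic cube of generation `n` with index `k ∈ ℤ^d`. -/
def dyadicCube (d n : ℕ) (k : Fin d → ℤ) : Set (Ed d) :=
  {x | ∀ i, x i ∈ Set.Ioc ((k i : ℝ) / 2 ^ n) (((k i : ℝ) + 1) / 2 ^ n)}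

/-- The family `𝒟_n` of dyadic cubes of generation `n`, forming a partition of `𝒬`. -/
def Dn (d n : ℕ) : Set (Set (Ed d)) :=
  {S | ∃ k : Fin d → ℤ, (∀ i, 0 ≤ k i ∧ k i < 2 ^ n) ∧ S = dyadicCube d n k}

/-- All dyadic cubes `𝒟 = ⋃_n 𝒟_n` (inside `𝒬`). -/
def Ddy (d : ℕ) : Set (Set (Ed d)) := ⋃ n, Dn d n

/-- All dyadic cubes of generation `n` in `ℝ^d`. -/
def DnAll (d n : ℕ) : Set (Set (Ed d)) := {S | ∃ k : Fin d → ℤ, S = dyadicCube d n k}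

/-- Index set enumerating the cubes of `𝒟_n`. -/
def idx (d n : ℕ) : Finset (Fin d → ℤ) :=
  Fintype.piFinset fun _ => Finset.Icc 0 (2 ^ n - 1)

/-- Lebesgue measure restricted to `𝒬`. -/
def Lam (d : ℕ) : Measure (Ed d) := volume.restrict (Qcube d)

/-- `dim_∞(ν) = liminf_n max_{Q ∈ 𝒟_n} log ν(Q) / log 2^{-n}`. -/
def dimInfty (d : ℕ) (ν : Measure (Ed d)) : ℝ :=
  liminf (fun n : ℕ =>
    (⨆ k ∈ idx d n, Real.log (ν (dyadicCube d n k)).toReal) / (-(n : ℝ) * Real.log 2)) atTop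

/-- The set function `J_{ν,r}(Q) = max_{Q' ∈ 𝒟(Q)} ν(Q') Λ(Q')^{r/d}`. -/
def Jf (d : ℕ) (ν : Measure (Ed d)) (r : ℝ) (Q : Set (Ed d)) : ℝ :=
  sSup {v : ℝ | ∃ Q' ∈ Ddy d, Q' ⊆ Q ∧ v = (ν Q').toReal * (Lam d Q').toReal ^ (r / (d:ℝ))}

/-- The `n`-th level `J`-partition sum exponent `τ_{J,n}(q)`. -/
def tauN (d : ℕ) (ν : Measure (Ed d)) (r q : ℝ) (n : ℕ) : ℝ :=
  Real.log (∑ k ∈ (idx d n).filter (fun k => 0 < Jf d ν r (dyadicCube d n k)),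
    Jf d ν r (dyadicCube d n k) ^ q) / ((n : ℝ) * Real.log 2)

/-- The `J`-partition function `τ_{J_{ν,r}}(q)`. -/
def tauJ (d : ℕ) (ν : Measure (Ed d)) (r q : ℝ) : ℝ :=
  limsup (tauN d ν r q) atTop

/-- The critical value `q_r = inf{q > 0 : τ_{J_{ν,r}}(q) < 0}`. -/
def qrCrit (d : ℕ) (ν : Measure (Ed d)) (r : ℝ) : ℝ :=
  sInf {q : ℝ | 0 < q ∧ tauJ d ν r q < 0}

/-- The `n`-th level `L^q`-sum exponent `β_{ν,n}(q)`. -/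
def betaN (d : ℕ) (ν : Measure (Ed d)) (q : ℝ) (n : ℕ) : ℝ :=
  Real.log (∑ k ∈ (idx d n).filter (fun k => 0 < ν (dyadicCube d n k)),
    ((ν (dyadicCube d n k)).toReal) ^ q) / ((n : ℝ) * Real.log 2)

/-- The `L^q`-spectrum `β_ν(q)`. -/
def betaNu (d : ℕ) (ν : Measure (Ed d)) (q : ℝ) : ℝ := limsup (betaN d ν q) atTop

/-- Upper Minkowski (box-counting) dimension of the support of `ν`, computed through the
number of dyadic cubes of positive measure. -/
def dimMUpper (d : ℕ) (ν : Measure (Ed d)) : ℝ :=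
  limsup (fun n : ℕ =>
    Real.log (((idx d n).filter fun k => 0 < ν (dyadicCube d n k)).card) /
      ((n : ℝ) * Real.log 2)) atTop

/-- `log⁺`. -/
def logPlus (x : ℝ) : ℝ := Real.log (max x 1)

/-- `N_{ν,α,r}(n) = card{Q ∈ 𝒟_n : J_{ν,r}(Q) ≥ 2^{-αn}}`. -/
def Ncount (d : ℕ) (ν : Measure (Ed d)) (α r : ℝ) (n : ℕ) : ℕ :=
  ((idx d n).filter fun k => (2:ℝ) ^ (-(α * (n:ℝ))) ≤ Jf d ν r (dyadicCube d n k)).card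

/-- `F̄_{ν,r}(α)`. -/
def FUpperAt (d : ℕ) (ν : Measure (Ed d)) (r α : ℝ) : ℝ :=
  limsup (fun n : ℕ => logPlus (Ncount d ν α r n) / ((n : ℝ) * Real.log 2)) atTop

/-- `F̲_{ν,r}(α)`. -/
def FLowerAt (d : ℕ) (ν : Measure (Ed d)) (r α : ℝ) : ℝ :=
  liminf (fun n : ℕ => logPlus (Ncount d ν α r n) / ((n : ℝ) * Real.log 2)) atTop

/-- The upper optimized coarse multifractal dimension `F̄_r = sup_{α>0} F̄_{ν,r}(α)/α`. -/
def FUpper (d : ℕ) (ν : Measure (Ed d)) (r : ℝ) : ℝ :=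
  sSup {v : ℝ | ∃ α : ℝ, 0 < α ∧ v = FUpperAt d ν r α / α}

/-- The lower optimized coarse multifractal dimension `F̲_r = sup_{α>0} F̲_{ν,r}(α)/α`. -/
def FLower (d : ℕ) (ν : Measure (Ed d)) (r : ℝ) : ℝ :=
  sSup {v : ℝ | ∃ α : ℝ, 0 < α ∧ v = FLowerAt d ν r α / α}

/-- A finite partition of `𝒬` by dyadic cubes. -/
def IsDyadicPartition (d : ℕ) (P : Finset (Set (Ed d))) : Prop :=
  (∀ Q ∈ P, Q ∈ Ddy d) ∧ (P : Set (Set (Ed d))).PairwiseDisjoint id ∧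
    ⋃₀ (P : Set (Set (Ed d))) = Qcube d

/-- `M_{ν,r}(x) = inf{card P : P ∈ Π, max_{Q ∈ P} J_{ν,r}(Q) < 1/x}`. -/
def Mx (d : ℕ) (ν : Measure (Ed d)) (r x : ℝ) : ℕ :=
  sInf {m : ℕ | ∃ P : Finset (Set (Ed d)), IsDyadicPartition d P ∧
    (∀ Q ∈ P, Jf d ν r Q < 1 / x) ∧ P.card = m}

/-- The upper `(ν,r)`-partition entropy `h̄_{ν,r}`. -/
def hUpper (d : ℕ) (ν : Measure (Ed d)) (r : ℝ) : ℝ :=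
  limsup (fun x : ℝ => Real.log (Mx d ν r x) / Real.log x) atTop

/-- The lower `(ν,r)`-partition entropy `h̲_{ν,r}`. -/
def hLowerBase (d : ℕ) (ν : Measure (Ed d)) (r : ℝ) : ℝ :=
  liminf (fun x : ℝ => Real.log (Mx d ν r x) / Real.log x) atTop

/-- `h̲_r = lim_{ε ↓ 0} h̲_{ν,r-ε}`. -/
def hLowerLim (d : ℕ) (ν : Measure (Ed d)) (r : ℝ) : ℝ :=
  limUnder (𝓝[>] (0:ℝ)) (fun ε => hLowerBase d ν (r - ε))

/-- The value `(∫ d(x,A)^r dν)^{1/r}` (resp. `exp ∫ log d(x,A) dν` for `r = 0`) of the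
quantization functional at the codebook `A`; computed in `[0,∞]` so that for `r < 0` a
non-integrable integrand gives the value `0`. -/
def eVal (d : ℕ) (ν : Measure (Ed d)) (A : Finset (Ed d)) (r : ℝ) : ℝ :=
  if r = 0 then Real.exp (∫ x, Real.log (infDist x (A : Set (Ed d))) ∂ν)
  else ((∫⁻ x, ENNReal.ofReal (infDist x (A : Set (Ed d))) ^ r ∂ν) ^ (1 / r)).toReal

/-- The `n`-th quantization error `e_{n,r}(ν)` of order `r`. -/
def qerr (d : ℕ) (ν : Measure (Ed d)) (n : ℕ) (r : ℝ) : ℝ :=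
  sInf {e : ℝ | ∃ A : Finset (Ed d), A.Nonempty ∧ A.card ≤ n ∧ e = eVal d ν A r}

/-- The upper quantization dimension `D̄_r(ν)` (with the convention `1/log 0 = 0`,
realized by `Real.log 0 = 0`). -/
def upperD (d : ℕ) (ν : Measure (Ed d)) (r : ℝ) : ℝ :=
  limsup (fun n : ℕ => Real.log n / (- Real.log (qerr d ν n r))) atTop

/-- The lower quantization dimension `D̲_r(ν)`. -/
def lowerD (d : ℕ) (ν : Measure (Ed d)) (r : ℝ) : ℝ :=
  liminf (fun n : ℕ => Real.log n / (- Real.log (qerr d ν n r))) atTop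

/-- The sequence `n^{1/κ} e_{n,r}(ν)`, viewed in `[0,∞]`. -/
def qcoefSeq (d : ℕ) (ν : Measure (Ed d)) (κ r : ℝ) (n : ℕ) : ℝ≥0∞ :=
  ENNReal.ofReal ((n : ℝ) ^ (1 / κ) * qerr d ν n r)

/-- The `κ`-dimensional quantization coefficient of order `r` exists and equals `c`. -/
def HasQCoef (d : ℕ) (ν : Measure (Ed d)) (κ r : ℝ) (c : ℝ≥0∞) : Prop :=
  Tendsto (qcoefSeq d ν κ r) atTop (𝓝 c)

/-- The `κ`-dimensional quantization coefficient of order `r` (junk value if the limit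
does not exist). -/
def qcoef (d : ℕ) (ν : Measure (Ed d)) (κ r : ℝ) : ℝ≥0∞ :=
  limUnder atTop (qcoefSeq d ν κ r)

/-- `s_h = sup{s > 0 : ‖h‖_{L^s(Λ)} < ∞}`. -/
def sCrit (d : ℕ) (h : Ed d → ℝ≥0∞) : ℝ :=
  sSup {s : ℝ | 0 < s ∧ ∫⁻ x in Qcube d, h x ^ s < ⊤}

/-- `Φ_r(h)`. -/
def Phi (d : ℕ) (r : ℝ) (h : Ed d → ℝ≥0∞) : ℝ :=
  if r ≤ -(d:ℝ) then 0
  else if r = 0 then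
    Real.exp (-(1/(d:ℝ)) * ∫ x in Qcube d, (h x).toReal * Real.log (h x).toReal)
  else ((∫⁻ x in Qcube d, h x ^ ((d:ℝ)/((d:ℝ)+r))) ^ (((d:ℝ)+r)/(d:ℝ) * (1/r))).toReal

/-- `a_ν = sup{q_r : r ∈ (-dim_∞(ν),0)}`, computed in `[0,∞]`. -/
def aNu (d : ℕ) (ν : Measure (Ed d)) : ℝ≥0∞ :=
  ⨆ r ∈ Set.Ioo (-(dimInfty d ν)) (0:ℝ), ENNReal.ofReal (qrCrit d ν r)

/-- `ν` is multifractal-regular at `r`. -/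
def MFregular (d : ℕ) (ν : Measure (Ed d)) (r : ℝ) : Prop :=
  FLower d ν r = FUpper d ν r

/-- `ν` is partition function regular at `r`. -/
def PFregular (d : ℕ) (ν : Measure (Ed d)) (r : ℝ) : Prop :=
  (∃ ε > 0, ∀ q ∈ Set.Ioo (qrCrit d ν r - ε) (qrCrit d ν r),
      Tendsto (tauN d ν r q) atTop (𝓝 (tauJ d ν r q))) ∨
  (Tendsto (tauN d ν r (qrCrit d ν r)) atTop (𝓝 (tauJ d ν r (qrCrit d ν r))) ∧
      DifferentiableAt ℝ (tauJ d ν r) (qrCrit d ν r))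

/-- Distance between two sets. -/
def setDist (d : ℕ) (S T : Set (Ed d)) : ℝ :=
  sInf {v : ℝ | ∃ x ∈ S, ∃ y ∈ T, v = dist x y}

/-- The `2^{-n+1}`-parallel set `B_n(Q̃)` of a dyadic cube `Q̃`. -/
def parSet (d n : ℕ) (Qt : Set (Ed d)) : Set (Ed d) :=
  ⋃ Q ∈ {Q ∈ DnAll d (n-1) | (closure Qt ∩ closure Q).Nonempty}, Q

/-- `V_{n,r}(μ) = sup_A ∫ d(x,A)^r dμ` for `r < 0`, computed in `[0,∞]`. -/
def Vnr (d : ℕ) (μ : Measure (Ed d)) (n : ℕ) (r : ℝ) : ℝ≥0∞ :=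
  ⨆ (A : Finset (Ed d)) (_ : A.Nonempty ∧ A.card ≤ n),
    ∫⁻ x, ENNReal.ofReal (infDist x (A : Set (Ed d))) ^ r ∂μ

/-- The index of the dyadic cube of generation `n` containing `x`. -/
def cubeIndex {d : ℕ} (n : ℕ) (x : Ed d) : Fin d → ℤ := fun i => ⌈x i * 2 ^ n⌉ - 1

lemma mem_dyadicCube_iff {d n : ℕ} {k : Fin d → ℤ} {x : Ed d} :
    x ∈ dyadicCube d n k ↔ cubeIndex n x = k := by
  simp only [dyadicCube, mem_ofPred_eq, mem_Ioc, cubeIndex, funext_iff]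
  refine forall_congr' fun i => ?_
  have h2 : (0 : ℝ) < 2 ^ n := by positivity
  rw [div_lt_iff₀ h2, le_div_iff₀ h2, sub_eq_iff_eq_add, Int.ceil_eq_iff]
  push_cast
  rw [add_sub_cancel_right]

lemma cubeIndex_mem_idx_iff {d n : ℕ} {x : Ed d} :
    cubeIndex n x ∈ idx d n ↔ x ∈ Qcube d := by
  simp only [idx, Fintype.mem_piFinset, Finset.mem_Icc, cubeIndex, Qcube, mem_ofPred_eq, mem_Ioc]
  refine forall_congr' fun i => ?_
  have h2 : (0 : ℝ) < 2 ^ n := by positivity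
  rw [sub_nonneg, sub_le_sub_iff_right, Int.one_le_ceil_iff, Int.ceil_le]
  push_cast
  rw [mul_pos_iff_of_pos_right h2, mul_le_iff_le_one_left h2]

lemma mem_idx_iff {d n : ℕ} {k : Fin d → ℤ} :
    k ∈ idx d n ↔ ∀ i, 0 ≤ k i ∧ k i < 2 ^ n := by
  simp [idx, Fintype.mem_piFinset]

lemma card_idx (d n : ℕ) : (idx d n).card = 2 ^ (d * n) := by
  simp only [idx, Fintype.card_piFinset, Int.card_Icc, Finset.prod_const, Finset.card_univ,
    Fintype.card_fin]
  rw [mul_comm, pow_mul]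
  congr 1
  simp only [sub_add_cancel, sub_zero]
  exact_mod_cast Int.toNat_natCast (2 ^ n)

/-- The upper corner of a dyadic cube. -/
def cubeCorner {d : ℕ} (n : ℕ) (k : Fin d → ℤ) : Ed d := fun i => ((k i : ℝ) + 1) / 2 ^ n

lemma cubeIndex_cubeCorner {d n : ℕ} (k : Fin d → ℤ) : cubeIndex n (cubeCorner n k) = k := by
  funext i
  have h2 : (2 : ℝ) ^ n ≠ 0 := by positivity
  simp only [cubeIndex, cubeCorner, div_mul_cancel₀ _ h2]
  rw [sub_eq_iff_eq_add, ← Int.ceil_intCast (R := ℝ) (k i + 1)]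
  push_cast
  rfl

lemma cubeIndex_succ {d n : ℕ} (x : Ed d) (i : Fin d) :
    cubeIndex n x i = cubeIndex (n + 1) x i / 2 := by
  simp only [cubeIndex]
  have h1 := Int.ceil_lt_add_one (x i * 2 ^ n)
  have h2 := Int.le_ceil (x i * 2 ^ n)
  have h3 := Int.ceil_lt_add_one (x i * 2 ^ (n + 1))
  have h4 := Int.le_ceil (x i * 2 ^ (n + 1))
  set a := ⌈x i * 2 ^ n⌉
  set b := ⌈x i * 2 ^ (n + 1)⌉
  have h5 : x i * 2 ^ (n + 1) = 2 * (x i * 2 ^ n) := by ring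
  rw [h5] at h3 h4
  have h6 : (2 * a : ℝ) < b + 2 := by linarith
  have h7 : (b : ℝ) < 2 * a + 1 := by linarith
  have h6' : 2 * a < b + 2 := by exact_mod_cast h6
  have h7' : b < 2 * a + 1 := by exact_mod_cast h7
  omega

lemma cubeIndex_eq_of_le {d n m : ℕ} (h : n ≤ m) {x y : Ed d}
    (hxy : cubeIndex m x = cubeIndex m y) : cubeIndex n x = cubeIndex n y := by
  induction m, h using Nat.le_induction with
  | base => exact hxy
  | succ m _ ih =>
    apply ih
    funext i
    rw [cubeIndex_succ x, cubeIndex_succ y, hxy]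

lemma mem_Ddy_iff {d : ℕ} {S : Set (Ed d)} :
    S ∈ Ddy d ↔ ∃ n, ∃ k ∈ idx d n, S = dyadicCube d n k := by
  simp only [Ddy, Dn, mem_iUnion, mem_ofPred_eq, mem_idx_iff]

lemma dyadicCube_mem_Ddy {d n : ℕ} {k : Fin d → ℤ} (hk : k ∈ idx d n) :
    dyadicCube d n k ∈ Ddy d := mem_Ddy_iff.2 ⟨n, k, hk, rfl⟩

lemma cubeCorner_mem {d n : ℕ} (k : Fin d → ℤ) : cubeCorner n k ∈ dyadicCube d n k :=
  mem_dyadicCube_iff.2 (cubeIndex_cubeCorner k)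

lemma dyadicCube_subset_Qcube {d n : ℕ} {k : Fin d → ℤ} (hk : k ∈ idx d n) :
    dyadicCube d n k ⊆ Qcube d := fun x hx => by
  rw [mem_dyadicCube_iff] at hx
  rw [← cubeIndex_mem_idx_iff (n := n), hx]
  exact hk

lemma dyadicCube_eq_pi {d n : ℕ} {k : Fin d → ℤ} :
    dyadicCube d n k = Set.pi univ fun i => Ioc ((k i : ℝ) / 2 ^ n) (((k i : ℝ) + 1) / 2 ^ n) := by
  ext x; simp [dyadicCube]

lemma measurableSet_dyadicCube {d n : ℕ} {k : Fin d → ℤ} : MeasurableSet (dyadicCube d n k) := by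
  rw [dyadicCube_eq_pi]
  exact MeasurableSet.univ_pi fun _ => measurableSet_Ioc

lemma measurableSet_Qcube (d : ℕ) : MeasurableSet (Qcube d) := by
  have : Qcube d = Set.pi univ fun _ => Ioc 0 1 := by ext x; simp [Qcube]
  rw [this]
  exact MeasurableSet.univ_pi fun _ => measurableSet_Ioc

lemma pairwiseDisjoint_dyadicCube {d n : ℕ} (s : Set (Fin d → ℤ)) :
    s.PairwiseDisjoint (dyadicCube d n) := by
  intro k _ l _ hkl
  refine Set.disjoint_left.2 fun x hx hy => hkl ?_
  rw [mem_dyadicCube_iff] at hx hy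
  rw [← hx, hy]

lemma sum_measure_dyadicCube {d : ℕ} (ν : Measure (Ed d)) [IsProbabilityMeasure ν]
    (n : ℕ) (s : Finset (Fin d → ℤ)) :
    ∑ k ∈ s, (ν (dyadicCube d n k)).toReal = (ν (⋃ k ∈ s, dyadicCube d n k)).toReal := by
  rw [measure_biUnion_finset (pairwiseDisjoint_dyadicCube _) fun _ _ => measurableSet_dyadicCube,
    ENNReal.toReal_sum fun _ _ => measure_ne_top _ _]

lemma sum_measure_dyadicCube_le {d : ℕ} (ν : Measure (Ed d)) [IsProbabilityMeasure ν]
    (n : ℕ) (s : Finset (Fin d → ℤ)) :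
    ∑ k ∈ s, (ν (dyadicCube d n k)).toReal ≤ 1 := by
  rw [sum_measure_dyadicCube]
  exact measureReal_le_one

lemma biUnion_idx_dyadicCube (d n : ℕ) : ⋃ k ∈ idx d n, dyadicCube d n k = Qcube d := by
  ext x
  simp only [mem_iUnion, mem_dyadicCube_iff, exists_prop, exists_eq_right']
  exact cubeIndex_mem_idx_iff

lemma exists_measure_dyadicCube_ge {d : ℕ} (ν : Measure (Ed d)) [IsProbabilityMeasure ν]
    (hsupp : ν (Qcube d)ᶜ = 0) (n : ℕ) :
    ∃ k ∈ idx d n, (2 : ℝ) ^ (-(d * n : ℝ)) ≤ (ν (dyadicCube d n k)).toReal := by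
  by_contra! h
  have h1 : ∑ k ∈ idx d n, (ν (dyadicCube d n k)).toReal = 1 := by
    rw [sum_measure_dyadicCube, biUnion_idx_dyadicCube,
      (prob_compl_eq_zero_iff (measurableSet_Qcube d)).1 hsupp, ENNReal.toReal_one]
  have hne : (idx d n).Nonempty := by
    rw [← Finset.card_pos, card_idx]; positivity
  have h2 := Finset.sum_lt_sum_of_nonempty hne h
  rw [h1, Finset.sum_const, card_idx, nsmul_eq_mul] at h2
  have h3 : ((2 ^ (d * n) : ℕ) : ℝ) = (2 : ℝ) ^ (d * n : ℝ) := by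
    rw [← Nat.cast_mul, Real.rpow_natCast]; push_cast; rfl
  rw [h3, ← Real.rpow_add two_pos, add_neg_cancel, Real.rpow_zero] at h2
  exact lt_irrefl _ h2

lemma Lam_dyadicCube {d n : ℕ} {k : Fin d → ℤ} (hd : 0 < d) (hk : k ∈ idx d n) (r : ℝ) :
    (Lam d (dyadicCube d n k)).toReal ^ (r / (d : ℝ)) = (2 : ℝ) ^ (-(r * n)) := by
  have h1 : Lam d (dyadicCube d n k) = volume (dyadicCube d n k) := by
    rw [Lam, Measure.restrict_apply measurableSet_dyadicCube,
      inter_eq_left.2 (dyadicCube_subset_Qcube hk)]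
  have hle : (fun i => (k i : ℝ) / 2 ^ n) ≤ fun i => ((k i : ℝ) + 1) / 2 ^ n := fun i => by
    dsimp only
    gcongr
    linarith
  have hd' : (d : ℝ) ≠ 0 := by positivity
  rw [h1, dyadicCube_eq_pi, Real.volume_pi_Ioc_toReal hle]
  have h2 : ∀ i, ((k i : ℝ) + 1) / 2 ^ n - (k i : ℝ) / 2 ^ n = (2 : ℝ) ^ (-(n : ℝ)) := fun i => by
    rw [Real.rpow_neg two_pos.le, Real.rpow_natCast]; ring
  simp only [h2, Finset.prod_const, Finset.card_univ, Fintype.card_fin]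
  rw [← Real.rpow_natCast, ← Real.rpow_mul two_pos.le, ← Real.rpow_mul two_pos.le]
  congr 1
  field_simp

lemma Jf_term_le {d : ℕ} (ν : Measure (Ed d)) [IsProbabilityMeasure ν] {r : ℝ}
    (hr : 0 < r) {n m : ℕ} {k l : Fin d → ℤ}
    (hsub : dyadicCube d m l ⊆ dyadicCube d n k) :
    (ν (dyadicCube d m l)).toReal * (Lam d (dyadicCube d m l)).toReal ^ (r / (d : ℝ)) ≤
      (ν (dyadicCube d n k)).toReal * (Lam d (dyadicCube d n k)).toReal ^ (r / (d : ℝ)) := by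
  have hfin : Lam d (dyadicCube d n k) ≠ ⊤ := by
    refine ((Measure.restrict_apply_le _ _).trans_lt ?_).ne
    rw [dyadicCube_eq_pi, Real.volume_pi_Ioc]
    exact ENNReal.prod_lt_top fun _ _ => ENNReal.ofReal_lt_top
  gcongr
  exact measure_ne_top _ _

/-- For positive orders the maximum defining `Jf` is attained at the cube itself. -/
lemma Jf_dyadicCube {d : ℕ} (hd : 0 < d) (ν : Measure (Ed d)) [IsProbabilityMeasure ν] {r : ℝ}
    (hr : 0 < r) {n : ℕ} {k : Fin d → ℤ} (hk : k ∈ idx d n) :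
    Jf d ν r (dyadicCube d n k) =
      (ν (dyadicCube d n k)).toReal * (2 : ℝ) ^ (-(r * n)) := by
  rw [← Lam_dyadicCube hd hk]
  refine IsGreatest.csSup_eq ⟨⟨_, dyadicCube_mem_Ddy hk, Subset.rfl, rfl⟩, ?_⟩
  rintro v ⟨Q', hQ', hsub, rfl⟩
  obtain ⟨m, l, hl, rfl⟩ := mem_Ddy_iff.1 hQ'
  exact Jf_term_le ν hr hsub

lemma Jf_nonneg {d : ℕ} (ν : Measure (Ed d)) (r : ℝ) (Q : Set (Ed d)) : 0 ≤ Jf d ν r Q := by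
  apply Real.sSup_nonneg
  rintro v ⟨Q', -, -, rfl⟩
  positivity

lemma Jf_le {d : ℕ} (hd : 0 < d) (ν : Measure (Ed d)) [IsProbabilityMeasure ν] {r : ℝ}
    (hr : 0 < r) {n : ℕ} {k : Fin d → ℤ} (hk : k ∈ idx d n) :
    Jf d ν r (dyadicCube d n k) ≤ (2 : ℝ) ^ (-(r * n)) := by
  rw [Jf_dyadicCube hd ν hr hk]
  exact mul_le_of_le_one_left (by positivity) measureReal_le_one

lemma Jf_le_one {d : ℕ} (hd : 0 < d) (ν : Measure (Ed d)) [IsProbabilityMeasure ν] {r : ℝ}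
    (hr : 0 < r) {n : ℕ} {k : Fin d → ℤ} (hk : k ∈ idx d n) :
    Jf d ν r (dyadicCube d n k) ≤ 1 :=
  (Jf_le hd ν hr hk).trans (Real.rpow_le_one_of_one_le_of_nonpos one_le_two
    (neg_nonpos.2 (by positivity)))

lemma dist_le_of_mem_dyadicCube {d n : ℕ} {k : Fin d → ℤ} {x y : Ed d}
    (hx : x ∈ dyadicCube d n k) (hy : y ∈ dyadicCube d n k) :
    dist x y ≤ (2 : ℝ) ^ (-(n : ℝ)) := by
  have h2 : (2 : ℝ) ^ (-(n : ℝ)) = 1 / 2 ^ n := by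
    rw [Real.rpow_neg two_pos.le, Real.rpow_natCast, one_div]
  refine (dist_pi_le_iff (by positivity)).2 fun i => ?_
  have h := add_div (k i : ℝ) 1 (2 ^ n)
  obtain ⟨h3, h4⟩ := hx i
  obtain ⟨h5, h6⟩ := hy i
  rw [Real.dist_eq, abs_le, h2]
  constructor <;> linarith

lemma eVal_nonneg {d : ℕ} (ν : Measure (Ed d)) (A : Finset (Ed d)) (r : ℝ) :
    0 ≤ eVal d ν A r := by
  unfold eVal
  split_ifs <;> positivity

lemma qerr_nonneg {d : ℕ} (ν : Measure (Ed d)) (n : ℕ) (r : ℝ) : 0 ≤ qerr d ν n r := by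
  apply Real.sInf_nonneg
  rintro v ⟨A, -, -, rfl⟩
  exact eVal_nonneg ν A r

lemma qerr_le_eVal {d : ℕ} (ν : Measure (Ed d)) {n : ℕ} (r : ℝ) {A : Finset (Ed d)}
    (hA : A.Nonempty) (hn : A.card ≤ n) : qerr d ν n r ≤ eVal d ν A r := by
  refine csInf_le ⟨0, ?_⟩ ⟨A, hA, hn, rfl⟩
  rintro v ⟨A, -, -, rfl⟩
  exact eVal_nonneg ν A r

lemma eVal_rpow {d : ℕ} (ν : Measure (Ed d)) {r : ℝ} (hr : 0 < r) (A : Finset (Ed d)) :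
    eVal d ν A r ^ r =
      (∫⁻ x, ENNReal.ofReal (infDist x (A : Set (Ed d))) ^ r ∂ν).toReal := by
  rw [eVal, if_neg hr.ne', ENNReal.toReal_rpow, ← ENNReal.rpow_mul, one_div_mul_cancel hr.ne',
    ENNReal.rpow_one]

lemma IsDyadicPartition.nonempty {d : ℕ} {P : Finset (Set (Ed d))} (hP : IsDyadicPartition d P) :
    P.Nonempty := by
  have h : (fun _ => 1 : Ed d) ∈ ⋃₀ (P : Set (Set (Ed d))) := by
    rw [hP.2.2]
    intro i
    simp
  obtain ⟨Q, hQ, -⟩ := h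
  exact ⟨Q, hQ⟩

/-- Placing one point in each cube of a dyadic partition bounds the quantization error. -/
lemma qerr_rpow_le {d : ℕ} (hd : 0 < d) (ν : Measure (Ed d)) [IsProbabilityMeasure ν]
    (hsupp : ν (Qcube d)ᶜ = 0) {r : ℝ} (hr : 0 < r) {x : ℝ} (hx : 0 < x)
    {P : Finset (Set (Ed d))} (hP : IsDyadicPartition d P)
    (hJ : ∀ Q ∈ P, Jf d ν r Q < 1 / x) {N : ℕ} (hN : P.card ≤ N) :
    qerr d ν N r ^ r ≤ N / x := by
  have hne : ∀ Q : P, ∃ y, y ∈ (Q : Set (Ed d)) := fun Q => by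
    obtain ⟨n, k, hk, h⟩ := mem_Ddy_iff.1 (hP.1 Q Q.2)
    exact ⟨_, h ▸ cubeCorner_mem k⟩
  choose c hc using hne
  set A : Finset (Ed d) := P.attach.image c
  have hA : A.Nonempty := (Finset.attach_nonempty_iff.2 hP.nonempty).image _
  have hcard : A.card ≤ N := Finset.card_image_le.trans (by rwa [Finset.card_attach])
  have hQ : ∀ Q ∈ P, ∫⁻ y in Q, ENNReal.ofReal (infDist y (A : Set (Ed d))) ^ r ∂ν ≤
      ENNReal.ofReal (1 / x) := fun Q hQ => by
    obtain ⟨n, k, hk, h⟩ := mem_Ddy_iff.1 (hP.1 Q hQ)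
    have hcA : c ⟨Q, hQ⟩ ∈ (A : Set (Ed d)) :=
      Finset.mem_coe.2 (Finset.mem_image_of_mem c (Finset.mem_attach _ _))
    calc ∫⁻ y in Q, ENNReal.ofReal (infDist y (A : Set (Ed d))) ^ r ∂ν
        ≤ ∫⁻ y in Q, ENNReal.ofReal ((2 : ℝ) ^ (-(r * n))) ∂ν := by
          refine setLIntegral_mono measurable_const fun y hy => ?_
          rw [ENNReal.ofReal_rpow_of_nonneg infDist_nonneg hr.le]
          refine ENNReal.ofReal_le_ofReal ?_
          have h1 : infDist y (A : Set (Ed d)) ≤ (2 : ℝ) ^ (-(n : ℝ)) :=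
            (infDist_le_dist_of_mem hcA).trans
              (dist_le_of_mem_dyadicCube (h ▸ hy) (h ▸ hc ⟨Q, hQ⟩))
          calc _ ≤ ((2 : ℝ) ^ (-(n : ℝ))) ^ r := Real.rpow_le_rpow infDist_nonneg h1 hr.le
            _ = _ := by rw [← Real.rpow_mul two_pos.le]; congr 1; ring
      _ = ENNReal.ofReal (Jf d ν r Q) := by
          rw [setLIntegral_const, h, Jf_dyadicCube hd ν hr hk,
            ENNReal.ofReal_mul ENNReal.toReal_nonneg, ENNReal.ofReal_toReal (measure_ne_top _ _),
            mul_comm]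
      _ ≤ _ := ENNReal.ofReal_le_ofReal (hJ Q hQ).le
  have hint : ∫⁻ y, ENNReal.ofReal (infDist y (A : Set (Ed d))) ^ r ∂ν ≤
      ENNReal.ofReal (N / x) := by
    have hae : ν = ν.restrict (⋃ Q ∈ P, Q) := by
      have hU : ⋃ Q ∈ P, Q = Qcube d := by
        rw [← hP.2.2, sUnion_eq_biUnion]
        rfl
      rw [hU, Measure.restrict_eq_self_of_ae_mem]
      exact mem_ae_iff.2 hsupp
    have hmeas : ∀ Q ∈ P, MeasurableSet Q := fun Q hQ => by
      obtain ⟨n, k, hk, rfl⟩ := mem_Ddy_iff.1 (hP.1 Q hQ)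
      exact measurableSet_dyadicCube
    rw [hae, lintegral_biUnion_finset (t := fun Q => Q) hP.2.1 hmeas]
    calc _ ≤ ∑ Q ∈ P, ENNReal.ofReal (1 / x) := Finset.sum_le_sum hQ
      _ = ENNReal.ofReal (P.card / x) := by
        rw [Finset.sum_const, nsmul_eq_mul, ← ENNReal.ofReal_natCast,
          ← ENNReal.ofReal_mul (Nat.cast_nonneg _), mul_one_div]
      _ ≤ _ := ENNReal.ofReal_le_ofReal (by gcongr)
  calc qerr d ν N r ^ r ≤ eVal d ν A r ^ r :=
        Real.rpow_le_rpow (qerr_nonneg ν N r) (qerr_le_eVal ν r hA hcard) hr.le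
    _ = (∫⁻ y, ENNReal.ofReal (infDist y (A : Set (Ed d))) ^ r ∂ν).toReal := eVal_rpow ν hr A
    _ ≤ N / x := ENNReal.toReal_le_of_le_ofReal (by positivity) hint

/-- Indices of the cubes adjacent to the cubes meeting a finite set. -/
def nearIndices {d : ℕ} (n : ℕ) (A : Finset (Ed d)) : Finset (Fin d → ℤ) :=
  (A ×ˢ Fintype.piFinset fun _ : Fin d => Finset.Icc (-1 : ℤ) 1).image
    fun p => cubeIndex n p.1 + p.2

lemma card_nearIndices_le {d : ℕ} (n : ℕ) (A : Finset (Ed d)) :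
    (nearIndices n A).card ≤ 3 ^ d * A.card := by
  refine Finset.card_image_le.trans_eq ?_
  simp [mul_comm]

lemma le_infDist_of_notMem_nearIndices {d n : ℕ} {A : Finset (Ed d)} (hA : A.Nonempty)
    {k : Fin d → ℤ} (hk : k ∉ nearIndices n A) {x : Ed d} (hx : x ∈ dyadicCube d n k) :
    (2 : ℝ) ^ (-(n : ℝ)) ≤ infDist x (A : Set (Ed d)) := by
  by_contra! h
  obtain ⟨a, ha, hxa⟩ := (infDist_lt_iff (Finset.coe_nonempty.2 hA)).1 h
  refine hk (Finset.mem_image.2 ⟨(a, k - cubeIndex n a), ?_, by simp⟩)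
  rw [Finset.mem_product]
  refine ⟨ha, ?_⟩
  rw [Fintype.mem_piFinset]
  intro i
  have h2 : (0 : ℝ) < 2 ^ n := by positivity
  have hdist : |x i - a i| < (2 : ℝ) ^ (-(n : ℝ)) := by
    rw [← Real.dist_eq]
    exact (dist_le_pi_dist x a i).trans_lt hxa
  rw [Real.rpow_neg two_pos.le, Real.rpow_natCast, ← one_div, lt_div_iff₀ h2, ← abs_of_pos h2,
    ← abs_mul, sub_mul, abs_lt] at hdist
  rw [← mem_dyadicCube_iff.1 hx]
  simp only [Pi.sub_apply, cubeIndex, Finset.mem_Icc]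
  have hx1 := Int.ceil_lt_add_one (x i * 2 ^ n)
  have hx2 := Int.le_ceil (x i * 2 ^ n)
  have ha1 := Int.ceil_lt_add_one (a i * 2 ^ n)
  have ha2 := Int.le_ceil (a i * 2 ^ n)
  set u := ⌈x i * 2 ^ n⌉
  set v := ⌈a i * 2 ^ n⌉
  have h3 : (u : ℝ) < v + 2 := by linarith
  have h4 : (v : ℝ) < u + 2 := by linarith
  have h3' : u < v + 2 := by exact_mod_cast h3
  have h4' : v < u + 2 := by exact_mod_cast h4
  omega

/-- A codebook with few points misses many of the cubes with large mass. -/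
lemma Ncount_le_qerr_rpow {d : ℕ} (hd : 0 < d) (ν : Measure (Ed d)) [IsProbabilityMeasure ν]
    (hsupp : ν (Qcube d)ᶜ = 0) {r : ℝ} (hr : 0 < r) {α : ℝ} {n m : ℕ} (hm : 0 < m)
    (hN : 2 * 3 ^ d * m ≤ Ncount d ν α r n) :
    (Ncount d ν α r n : ℝ) / 2 * 2 ^ (-(α * n)) ≤ qerr d ν m r ^ r := by
  have key : ∀ A : Finset (Ed d), A.Nonempty → A.card ≤ m →
      (Ncount d ν α r n : ℝ) / 2 * 2 ^ (-(α * n)) ≤ eVal d ν A r ^ r := by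
    intro A hA hAm
    rw [eVal_rpow ν hr]
    set S := (idx d n).filter fun k => (2:ℝ) ^ (-(α * (n:ℝ))) ≤ Jf d ν r (dyadicCube d n k)
    set T := S \ nearIndices n A
    have hT : (Ncount d ν α r n : ℝ) / 2 ≤ T.card := by
      have h1 : S.card - (nearIndices n A).card ≤ T.card := Finset.le_card_sdiff _ _
      have h2 := card_nearIndices_le n A
      have h3 : 3 ^ d * A.card ≤ 3 ^ d * m := Nat.mul_le_mul_left _ hAm
      have h4 : S.card = Ncount d ν α r n := rfl
      have h5 : Ncount d ν α r n ≤ 2 * T.card := by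
        rw [mul_assoc] at hN
        omega
      have h6 : (Ncount d ν α r n : ℝ) ≤ 2 * T.card := by exact_mod_cast h5
      linarith
    have hfin : ∫⁻ x, ENNReal.ofReal (infDist x (A : Set (Ed d))) ^ r ∂ν ≠ ⊤ := by
      obtain ⟨a, ha⟩ := hA
      refine ne_top_of_le_ne_top (b := ENNReal.ofReal (1 + dist 0 a) ^ r)
        (ENNReal.rpow_ne_top_of_nonneg hr.le ENNReal.ofReal_ne_top) ?_
      calc _ ≤ ∫⁻ _, ENNReal.ofReal (1 + dist 0 a) ^ r ∂ν := by
            refine lintegral_mono_ae ?_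
            filter_upwards [mem_ae_iff.2 hsupp] with x hx
            refine ENNReal.rpow_le_rpow (ENNReal.ofReal_le_ofReal ?_) hr.le
            have hx0 : dist x 0 ≤ 1 := (dist_pi_le_iff zero_le_one).2 fun i => by
              obtain ⟨h1, h2⟩ := hx i
              rw [Pi.zero_apply, Real.dist_eq, sub_zero, abs_of_pos h1]
              exact h2
            exact (infDist_le_dist_of_mem (Finset.mem_coe.2 ha)).trans
              ((dist_triangle x 0 a).trans (by gcongr))
        _ = _ := by simp
    rw [← ENNReal.ofReal_le_iff_le_toReal hfin]
    calc ENNReal.ofReal ((Ncount d ν α r n : ℝ) / 2 * 2 ^ (-(α * n)))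
        ≤ ENNReal.ofReal (T.card * 2 ^ (-(α * n))) := ENNReal.ofReal_le_ofReal (by gcongr)
      _ = ∑ k ∈ T, ENNReal.ofReal ((2 : ℝ) ^ (-(α * n))) := by
          rw [Finset.sum_const, nsmul_eq_mul, ENNReal.ofReal_mul (by positivity),
            ENNReal.ofReal_natCast]
      _ ≤ ∑ k ∈ T, ∫⁻ x in dyadicCube d n k,
            ENNReal.ofReal (infDist x (A : Set (Ed d))) ^ r ∂ν := by
          refine Finset.sum_le_sum fun k hk => ?_
          obtain ⟨hkS, hkA⟩ := Finset.mem_sdiff.1 hk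
          obtain ⟨hkidx, hkJ⟩ := Finset.mem_filter.1 hkS
          rw [Jf_dyadicCube hd ν hr hkidx] at hkJ
          calc ENNReal.ofReal ((2 : ℝ) ^ (-(α * n)))
              ≤ ENNReal.ofReal ((ν (dyadicCube d n k)).toReal * 2 ^ (-(r * n))) :=
                ENNReal.ofReal_le_ofReal hkJ
            _ = ∫⁻ _ in dyadicCube d n k, ENNReal.ofReal ((2 : ℝ) ^ (-(r * n))) ∂ν := by
                rw [setLIntegral_const, ENNReal.ofReal_mul ENNReal.toReal_nonneg,
                  ENNReal.ofReal_toReal (measure_ne_top _ _), mul_comm]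
            _ ≤ _ := by
                refine setLIntegral_mono' measurableSet_dyadicCube fun x hx => ?_
                rw [ENNReal.ofReal_rpow_of_nonneg infDist_nonneg hr.le]
                refine ENNReal.ofReal_le_ofReal ?_
                calc (2 : ℝ) ^ (-(r * n)) = ((2 : ℝ) ^ (-(n : ℝ))) ^ r := by
                      rw [← Real.rpow_mul two_pos.le]; congr 1; ring
                  _ ≤ _ := Real.rpow_le_rpow (by positivity)
                      (le_infDist_of_notMem_nearIndices hA hkA hx) hr.le
      _ = ∫⁻ x in ⋃ k ∈ T, dyadicCube d n k,
            ENNReal.ofReal (infDist x (A : Set (Ed d))) ^ r ∂ν :=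
          (lintegral_biUnion_finset (pairwiseDisjoint_dyadicCube _)
            (fun _ _ => measurableSet_dyadicCube) _).symm
      _ ≤ _ := setLIntegral_le_lintegral _ _
  have hc : (0 : ℝ) ≤ (Ncount d ν α r n : ℝ) / 2 * 2 ^ (-(α * n)) := by positivity
  rw [← Real.rpow_inv_le_iff_of_pos hc (qerr_nonneg ν m r) hr]
  refine le_csInf ⟨_, {0}, Finset.singleton_nonempty _, by rwa [Finset.card_singleton], rfl⟩ ?_
  rintro v ⟨A, hA, hAm, rfl⟩
  rw [Real.rpow_inv_le_iff_of_pos hc (eVal_nonneg ν A r) hr]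
  exact key A hA hAm

/-- The cubes of generation `n` at which `Jf` drops below `1 / x` for the first time. -/
def stoppingIndices (d : ℕ) (ν : Measure (Ed d)) (r x : ℝ) (n : ℕ) : Finset (Fin d → ℤ) :=
  (idx d n).filter fun k => Jf d ν r (dyadicCube d n k) < 1 / x ∧
    ∀ y ∈ dyadicCube d n k, ∀ m < n, 1 / x ≤ Jf d ν r (dyadicCube d m (cubeIndex m y))

/-- The cubes of generation `n` at which `Jf` is at least `1 / x`. -/
def heavyIndices (d : ℕ) (ν : Measure (Ed d)) (r x : ℝ) (n : ℕ) : Finset (Fin d → ℤ) :=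
  (idx d n).filter fun k => 1 / x ≤ Jf d ν r (dyadicCube d n k)

lemma card_stoppingIndices_succ_le {d : ℕ} (ν : Measure (Ed d)) (r x : ℝ) (n : ℕ) :
    (stoppingIndices d ν r x (n + 1)).card ≤ 2 ^ d * (heavyIndices d ν r x n).card := by
  have hsub : stoppingIndices d ν r x (n + 1) ⊆
      (heavyIndices d ν r x n ×ˢ Fintype.piFinset fun _ : Fin d => Finset.Icc (0 : ℤ) 1).image
        fun p i => 2 * p.1 i + p.2 i := by
    intro k hk
    obtain ⟨hkidx, -, hk⟩ := Finset.mem_filter.1 hk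
    have hc := cubeCorner_mem (n := n + 1) k
    refine Finset.mem_image.2
      ⟨(cubeIndex n (cubeCorner (n + 1) k), fun i => k i % 2), ?_, ?_⟩
    · refine Finset.mem_product.2 ⟨Finset.mem_filter.2 ⟨?_, hk _ hc n n.lt_succ_self⟩, ?_⟩
      · rw [cubeIndex_mem_idx_iff]
        exact dyadicCube_subset_Qcube hkidx hc
      · rw [Fintype.mem_piFinset]
        intro i
        rw [Finset.mem_Icc]
        dsimp only
        omega
    · funext i
      dsimp only
      rw [cubeIndex_succ, cubeIndex_cubeCorner]
      omega
  refine (Finset.card_le_card hsub).trans (Finset.card_image_le.trans_eq ?_)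
  simp [mul_comm]

lemma card_heavyIndices_le {d : ℕ} (ν : Measure (Ed d)) (r : ℝ) {x q : ℝ} (hx : 0 < x)
    (hq : 0 ≤ q) (n : ℕ) :
    ((heavyIndices d ν r x n).card : ℝ) ≤
      x ^ q * ∑ k ∈ idx d n, Jf d ν r (dyadicCube d n k) ^ q := by
  calc ((heavyIndices d ν r x n).card : ℝ)
      = ∑ k ∈ heavyIndices d ν r x n, 1 := by simp
    _ ≤ ∑ k ∈ heavyIndices d ν r x n, x ^ q * Jf d ν r (dyadicCube d n k) ^ q := by
        refine Finset.sum_le_sum fun k hk => ?_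
        rw [← Real.mul_rpow hx.le (Jf_nonneg ν r _)]
        refine Real.one_le_rpow ?_ hq
        have h := (Finset.mem_filter.1 hk).2
        rwa [div_le_iff₀' hx] at h
    _ ≤ ∑ k ∈ idx d n, x ^ q * Jf d ν r (dyadicCube d n k) ^ q := by
        refine Finset.sum_le_sum_of_subset_of_nonneg (Finset.filter_subset _ _) fun k _ _ => ?_
        have := Jf_nonneg ν r (dyadicCube d n k)
        positivity
    _ = _ := by rw [Finset.mul_sum]

/-- The stopping-time partition has cardinality controlled by the summed partition functions. -/
lemma exists_isDyadicPartition {d : ℕ} (hd : 0 < d) (ν : Measure (Ed d))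
    [IsProbabilityMeasure ν] {r : ℝ} (hr : 0 < r) {q S : ℝ} (hq : 0 ≤ q)
    (hS : ∀ n, ∑ m ∈ Finset.range n, ∑ k ∈ idx d m, Jf d ν r (dyadicCube d m k) ^ q ≤ S)
    {x : ℝ} (hx : 1 ≤ x) :
    ∃ P : Finset (Set (Ed d)), IsDyadicPartition d P ∧ (∀ Q ∈ P, Jf d ν r Q < 1 / x) ∧
      (P.card : ℝ) ≤ (1 + 2 ^ d * S) * x ^ q := by
  have hx0 : 0 < x := one_pos.trans_le hx
  obtain ⟨n₀, hn₀⟩ : ∃ n : ℕ, ((2 : ℝ) ^ (-r)) ^ n < 1 / x :=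
    exists_pow_lt_of_lt_one (by positivity)
      (Real.rpow_lt_one_of_one_lt_of_neg one_lt_two (neg_neg_of_pos hr))
  rw [← Real.rpow_natCast, ← Real.rpow_mul two_pos.le, neg_mul] at hn₀
  set P : Finset (Set (Ed d)) := (Finset.range (n₀ + 1)).biUnion fun n =>
    (stoppingIndices d ν r x n).image (dyadicCube d n) with hPdef
  have hmem : ∀ Q, Q ∈ P ↔ ∃ n ≤ n₀, ∃ k ∈ stoppingIndices d ν r x n, dyadicCube d n k = Q := by
    simp [hPdef]
  refine ⟨P, ⟨?_, ?_, ?_⟩, ?_, ?_⟩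
  · intro Q hQ
    obtain ⟨n, -, k, hk, rfl⟩ := (hmem Q).1 hQ
    exact dyadicCube_mem_Ddy (Finset.mem_filter.1 hk).1
  · have aux : ∀ {n m : ℕ} {k l : Fin d → ℤ}, k ∈ stoppingIndices d ν r x n →
        l ∈ stoppingIndices d ν r x m → ∀ y ∈ dyadicCube d n k, y ∈ dyadicCube d m l →
        ¬ n < m := by
      intro n m k l hk hl y hyk hyl hnm
      have h1 := (Finset.mem_filter.1 hl).2.2 y hyl n hnm
      rw [mem_dyadicCube_iff.1 hyk] at h1
      exact h1.not_gt (Finset.mem_filter.1 hk).2.1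
    intro Q hQ Q' hQ' hne
    obtain ⟨n, -, k, hk, rfl⟩ := (hmem Q).1 hQ
    obtain ⟨m, -, l, hl, rfl⟩ := (hmem Q').1 hQ'
    refine Set.disjoint_left.2 fun y hy hy' => hne ?_
    obtain rfl : n = m := le_antisymm (not_lt.1 (aux hl hk y hy' hy))
      (not_lt.1 (aux hk hl y hy hy'))
    rw [← mem_dyadicCube_iff.1 hy, ← mem_dyadicCube_iff.1 hy']
  · ext y
    simp only [mem_sUnion, Finset.mem_coe]
    constructor
    · rintro ⟨Q, hQ, hy⟩
      obtain ⟨n, -, k, hk, rfl⟩ := (hmem Q).1 hQ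
      exact dyadicCube_subset_Qcube (Finset.mem_filter.1 hk).1 hy
    · intro hy
      have hex : Jf d ν r (dyadicCube d n₀ (cubeIndex n₀ y)) < 1 / x :=
        (Jf_le hd ν hr (cubeIndex_mem_idx_iff.2 hy)).trans_lt hn₀
      have hex' : ∃ n, Jf d ν r (dyadicCube d n (cubeIndex n y)) < 1 / x := ⟨n₀, hex⟩
      refine ⟨dyadicCube d (Nat.find hex') (cubeIndex (Nat.find hex') y),
        (hmem _).2 ⟨_, Nat.find_min' hex' hex, _, Finset.mem_filter.2
          ⟨cubeIndex_mem_idx_iff.2 hy, Nat.find_spec hex', ?_⟩, rfl⟩, mem_dyadicCube_iff.2 rfl⟩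
      intro z hz m hm
      rw [cubeIndex_eq_of_le hm.le (mem_dyadicCube_iff.1 hz)]
      exact not_lt.1 (Nat.find_min hex' hm)
  · intro Q hQ
    obtain ⟨n, -, k, hk, rfl⟩ := (hmem Q).1 hQ
    exact (Finset.mem_filter.1 hk).2.1
  · have h0 : (stoppingIndices d ν r x 0).card ≤ 1 :=
      (Finset.card_le_card (Finset.filter_subset _ _)).trans (by rw [card_idx]; simp)
    have h1 : P.card ≤ ∑ n ∈ Finset.range n₀, 2 ^ d * (heavyIndices d ν r x n).card + 1 := by
      refine Finset.card_biUnion_le.trans ((Finset.sum_le_sum fun n _ =>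
        Finset.card_image_le).trans ?_)
      rw [Finset.sum_range_succ']
      exact add_le_add (Finset.sum_le_sum fun n _ => card_stoppingIndices_succ_le ν r x n) h0
    have h2 : (P.card : ℝ) ≤
        ∑ n ∈ Finset.range n₀, 2 ^ d * ((heavyIndices d ν r x n).card : ℝ) + 1 := by
      exact_mod_cast h1
    calc (P.card : ℝ) ≤ _ := h2
      _ ≤ ∑ n ∈ Finset.range n₀,
            2 ^ d * (x ^ q * ∑ k ∈ idx d n, Jf d ν r (dyadicCube d n k) ^ q) + x ^ q := by
          gcongr with n
          · exact card_heavyIndices_le ν r hx0 hq n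
          · exact Real.one_le_rpow hx hq
      _ = (1 + 2 ^ d * ∑ n ∈ Finset.range n₀,
            ∑ k ∈ idx d n, Jf d ν r (dyadicCube d n k) ^ q) * x ^ q := by
          rw [← Finset.mul_sum, ← Finset.mul_sum]; ring
      _ ≤ _ := by
          gcongr
          exact hS n₀

lemma Mx_le_card {d : ℕ} {ν : Measure (Ed d)} {r x : ℝ} {P : Finset (Set (Ed d))}
    (hP : IsDyadicPartition d P) (hJ : ∀ Q ∈ P, Jf d ν r Q < 1 / x) : Mx d ν r x ≤ P.card :=
  Nat.sInf_le ⟨P, hP, hJ, rfl⟩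

lemma sum_Jf_le {d : ℕ} (hd : 0 < d) (ν : Measure (Ed d)) [IsProbabilityMeasure ν] {r : ℝ}
    (hr : 0 < r) (n : ℕ) :
    ∑ k ∈ idx d n, Jf d ν r (dyadicCube d n k) ≤ (2 : ℝ) ^ (-(r * n)) := by
  rw [Finset.sum_congr rfl fun k hk => Jf_dyadicCube hd ν hr hk, ← Finset.sum_mul]
  exact mul_le_of_le_one_left (by positivity) (sum_measure_dyadicCube_le ν n _)

lemma exists_sum_Jf_le {d : ℕ} (hd : 0 < d) (ν : Measure (Ed d)) [IsProbabilityMeasure ν] {r : ℝ}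
    (hr : 0 < r) :
    ∃ S, 0 ≤ S ∧
      ∀ n, ∑ m ∈ Finset.range n, ∑ k ∈ idx d m, Jf d ν r (dyadicCube d m k) ^ (1 : ℝ) ≤ S := by
  have hlt : (2 : ℝ) ^ (-r) < 1 :=
    Real.rpow_lt_one_of_one_lt_of_neg one_lt_two (neg_neg_of_pos hr)
  have hg := summable_geometric_of_lt_one (by positivity) hlt
  refine ⟨∑' n : ℕ, ((2 : ℝ) ^ (-r)) ^ n, by positivity, fun n => ?_⟩
  refine le_trans (Finset.sum_le_sum fun m _ => ?_) (hg.sum_le_tsum (Finset.range n)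
    fun _ _ => by positivity)
  simp only [Real.rpow_one]
  rw [← Real.rpow_natCast, ← Real.rpow_mul two_pos.le, neg_mul]
  exact sum_Jf_le hd ν hr m

lemma exists_partition_card_eq_Mx {d : ℕ} (hd : 0 < d) (ν : Measure (Ed d))
    [IsProbabilityMeasure ν] {r : ℝ} (hr : 0 < r) {x : ℝ} (hx : 1 ≤ x) :
    ∃ P : Finset (Set (Ed d)), IsDyadicPartition d P ∧ (∀ Q ∈ P, Jf d ν r Q < 1 / x) ∧
      P.card = Mx d ν r x := by
  obtain ⟨S, -, hS⟩ := exists_sum_Jf_le hd ν hr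
  obtain ⟨P, hP, hJ, -⟩ := exists_isDyadicPartition hd ν hr zero_le_one hS hx
  exact Nat.sInf_mem (s := {m : ℕ | ∃ P : Finset (Set (Ed d)), IsDyadicPartition d P ∧
    (∀ Q ∈ P, Jf d ν r Q < 1 / x) ∧ P.card = m}) ⟨_, P, hP, hJ, rfl⟩

lemma one_le_Mx {d : ℕ} (hd : 0 < d) (ν : Measure (Ed d))
    [IsProbabilityMeasure ν] {r : ℝ} (hr : 0 < r) {x : ℝ} (hx : 1 ≤ x) : 1 ≤ Mx d ν r x := by
  obtain ⟨P, hP, -, hcard⟩ := exists_partition_card_eq_Mx hd ν hr hx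
  rw [← hcard]
  exact hP.nonempty.card_pos

lemma log_Mx_div_nonneg {d : ℕ} {ν : Measure (Ed d)} {r x : ℝ} (hx : 1 ≤ x) :
    0 ≤ Real.log (Mx d ν r x) / Real.log x :=
  div_nonneg (Real.log_natCast_nonneg _) (Real.log_nonneg hx)

/-- Boundedness of the summed partition functions at `q` bounds the partition entropy by `q`. -/
lemma eventually_log_Mx_div_le {d : ℕ} (hd : 0 < d) (ν : Measure (Ed d))
    [IsProbabilityMeasure ν] {r : ℝ} (hr : 0 < r) {q S : ℝ} (hq : 0 ≤ q) (hS0 : 0 ≤ S)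
    (hS : ∀ n, ∑ m ∈ Finset.range n, ∑ k ∈ idx d m, Jf d ν r (dyadicCube d m k) ^ q ≤ S)
    {q' : ℝ} (hq' : q < q') :
    ∀ᶠ x : ℝ in atTop, Real.log (Mx d ν r x) / Real.log x ≤ q' := by
  have hlog := Real.tendsto_log_atTop.eventually_ge_atTop
    (Real.log (1 + 2 ^ d * S) / (q' - q))
  filter_upwards [hlog, eventually_gt_atTop 1] with x hx hx1
  obtain ⟨P, hP, hJ, hcard⟩ := exists_isDyadicPartition hd ν hr hq hS hx1.le
  have hx0 : 0 < x := one_pos.trans hx1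
  have hM : (Mx d ν r x : ℝ) ≤ (1 + 2 ^ d * S) * x ^ q :=
    (Nat.cast_le.2 (Mx_le_card hP hJ)).trans hcard
  have hM1 : (0 : ℝ) < Mx d ν r x := Nat.cast_pos.2 (one_le_Mx hd ν hr hx1.le)
  rw [div_le_iff₀ (Real.log_pos hx1)]
  rw [div_le_iff₀ (sub_pos.2 hq')] at hx
  calc Real.log (Mx d ν r x) ≤ Real.log ((1 + 2 ^ d * S) * x ^ q) := Real.log_le_log hM1 hM
    _ = Real.log (1 + 2 ^ d * S) + q * Real.log x := by
        rw [Real.log_mul (by positivity) (by positivity), Real.log_rpow hx0]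
    _ ≤ q' * Real.log x := by linarith

lemma isBoundedUnder_le_log_Mx {d : ℕ} (hd : 0 < d) (ν : Measure (Ed d))
    [IsProbabilityMeasure ν] {r : ℝ} (hr : 0 < r) :
    IsBoundedUnder (· ≤ ·) atTop fun x : ℝ => Real.log (Mx d ν r x) / Real.log x := by
  obtain ⟨S, hS0, hS⟩ := exists_sum_Jf_le hd ν hr
  exact isBoundedUnder_of_eventually_le
    (eventually_log_Mx_div_le hd ν hr zero_le_one hS0 hS one_lt_two)

lemma isBoundedUnder_ge_log_Mx {d : ℕ} (ν : Measure (Ed d)) (r : ℝ) :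
    IsBoundedUnder (· ≥ ·) atTop fun x : ℝ => Real.log (Mx d ν r x) / Real.log x :=
  isBoundedUnder_of_eventually_ge <| by
    filter_upwards [eventually_ge_atTop 1] with x hx using log_Mx_div_nonneg hx

lemma tauN_eq {d : ℕ} (ν : Measure (Ed d)) (r : ℝ) {q : ℝ} (hq : 0 < q) (n : ℕ) :
    tauN d ν r q n =
      Real.log (∑ k ∈ idx d n, Jf d ν r (dyadicCube d n k) ^ q) / (n * Real.log 2) := by
  rw [tauN, Finset.sum_filter_of_ne]
  intro k _ hne
  refine (Jf_nonneg ν r _).lt_of_ne fun h => hne ?_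
  rw [← h, Real.zero_rpow hq.ne']

lemma le_sum_Jf_rpow {d : ℕ} (hd : 0 < d) (ν : Measure (Ed d)) [IsProbabilityMeasure ν]
    (hsupp : ν (Qcube d)ᶜ = 0) {r q : ℝ} (hr : 0 < r) (hq : 0 < q) (n : ℕ) :
    (2 : ℝ) ^ (-((d + r) * q * n)) ≤ ∑ k ∈ idx d n, Jf d ν r (dyadicCube d n k) ^ q := by
  obtain ⟨k, hk, hνk⟩ := exists_measure_dyadicCube_ge ν hsupp n
  calc (2 : ℝ) ^ (-((d + r) * q * n)) = ((2 : ℝ) ^ (-(d * n : ℝ)) * 2 ^ (-(r * n))) ^ q := by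
        rw [← Real.rpow_add two_pos, ← Real.rpow_mul two_pos.le]; congr 1; ring
    _ ≤ Jf d ν r (dyadicCube d n k) ^ q := by
        rw [Jf_dyadicCube hd ν hr hk]
        gcongr
    _ ≤ _ := Finset.single_le_sum
        (f := fun k => Jf d ν r (dyadicCube d n k) ^ q)
        (fun k _ => Real.rpow_nonneg (Jf_nonneg ν r _) q) hk

lemma sum_Jf_rpow_le {d : ℕ} (hd : 0 < d) (ν : Measure (Ed d)) [IsProbabilityMeasure ν]
    {r q : ℝ} (hr : 0 < r) (hq : 0 ≤ q) (n : ℕ) :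
    ∑ k ∈ idx d n, Jf d ν r (dyadicCube d n k) ^ q ≤ (2 : ℝ) ^ (d * n : ℝ) := by
  calc ∑ k ∈ idx d n, Jf d ν r (dyadicCube d n k) ^ q ≤ ∑ k ∈ idx d n, 1 :=
        Finset.sum_le_sum fun k hk =>
          Real.rpow_le_one (Jf_nonneg ν r _) (Jf_le_one hd ν hr hk) hq
    _ = _ := by
        rw [Finset.sum_const, card_idx, nsmul_one, ← Nat.cast_mul, Real.rpow_natCast]
        push_cast
        rfl

lemma eventually_tauN_ge {d : ℕ} (hd : 0 < d) (ν : Measure (Ed d)) [IsProbabilityMeasure ν]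
    (hsupp : ν (Qcube d)ᶜ = 0) {r q : ℝ} (hr : 0 < r) (hq : 0 < q) :
    ∀ᶠ n in atTop, -((d + r) * q) ≤ tauN d ν r q n := by
  filter_upwards [eventually_gt_atTop 0] with n hn
  have hn' : (0 : ℝ) < n * Real.log 2 := mul_pos (Nat.cast_pos.2 hn) (Real.log_pos one_lt_two)
  rw [tauN_eq ν r hq, le_div_iff₀ hn']
  have h := Real.log_le_log (by positivity) (le_sum_Jf_rpow hd ν hsupp hr hq n)
  rw [Real.log_rpow two_pos] at h
  linarith

lemma eventually_tauN_le {d : ℕ} (hd : 0 < d) (ν : Measure (Ed d)) [IsProbabilityMeasure ν]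
    (hsupp : ν (Qcube d)ᶜ = 0) {r q : ℝ} (hr : 0 < r) (hq : 0 < q) :
    ∀ᶠ n in atTop, tauN d ν r q n ≤ d := by
  filter_upwards [eventually_gt_atTop 0] with n hn
  have hn' : (0 : ℝ) < n * Real.log 2 := mul_pos (Nat.cast_pos.2 hn) (Real.log_pos one_lt_two)
  rw [tauN_eq ν r hq, div_le_iff₀ hn']
  have h := Real.log_le_log ((by positivity : (0 : ℝ) < 2 ^ (-((d + r) * q * n))).trans_le
    (le_sum_Jf_rpow hd ν hsupp hr hq n)) (sum_Jf_rpow_le hd ν hr hq.le n)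
  rw [Real.log_rpow two_pos] at h
  linarith

lemma exists_sum_Jf_rpow_le_of_tauJ_neg {d : ℕ} (hd : 0 < d) (ν : Measure (Ed d))
    [IsProbabilityMeasure ν] (hsupp : ν (Qcube d)ᶜ = 0) {r q : ℝ} (hr : 0 < r) (hq : 0 < q)
    (hτ : tauJ d ν r q < 0) :
    ∃ S, 0 ≤ S ∧
      ∀ n, ∑ m ∈ Finset.range n, ∑ k ∈ idx d m, Jf d ν r (dyadicCube d m k) ^ q ≤ S := by
  obtain ⟨c, hc1, hc0⟩ := exists_between hτ
  have hev : ∀ᶠ n in atTop, tauN d ν r q n < c :=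
    eventually_lt_of_limsup_lt hc1
      (isBoundedUnder_of_eventually_le (eventually_tauN_le hd ν hsupp hr hq))
  have hnn : ∀ n, 0 ≤ ∑ k ∈ idx d n, Jf d ν r (dyadicCube d n k) ^ q := fun n =>
    Finset.sum_nonneg fun k _ => Real.rpow_nonneg (Jf_nonneg ν r _) q
  have hsum : Summable fun n => ∑ k ∈ idx d n, Jf d ν r (dyadicCube d n k) ^ q := by
    have hg := summable_geometric_of_lt_one (r := (2 : ℝ) ^ c) (by positivity)
      (Real.rpow_lt_one_of_one_lt_of_neg one_lt_two hc0)
    refine Summable.of_norm_bounded_eventually_nat hg ?_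
    filter_upwards [hev, eventually_gt_atTop 0] with n hn hn0
    have hn' : (0 : ℝ) < n * Real.log 2 :=
      mul_pos (Nat.cast_pos.2 hn0) (Real.log_pos one_lt_two)
    have hpos := (by positivity : (0 : ℝ) < 2 ^ (-((d + r) * q * n))).trans_le
      (le_sum_Jf_rpow hd ν hsupp hr hq n)
    rw [tauN_eq ν r hq, div_lt_iff₀ hn'] at hn
    rw [Real.norm_of_nonneg (hnn n), ← Real.rpow_natCast, ← Real.rpow_mul two_pos.le,
      ← Real.log_le_log_iff hpos (by positivity), Real.log_rpow two_pos]
    linarith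
  exact ⟨_, tsum_nonneg hnn, fun n => hsum.sum_le_tsum _ fun m _ => hnn m⟩

lemma hUpper_le_of_tauJ_neg {d : ℕ} (hd : 0 < d) (ν : Measure (Ed d))
    [IsProbabilityMeasure ν] (hsupp : ν (Qcube d)ᶜ = 0) {r q : ℝ} (hr : 0 < r) (hq : 0 < q)
    (hτ : tauJ d ν r q < 0) : hUpper d ν r ≤ q := by
  obtain ⟨S, hS0, hS⟩ := exists_sum_Jf_rpow_le_of_tauJ_neg hd ν hsupp hr hq hτ
  refine le_of_forall_gt_imp_ge_of_dense fun q' hq' => ?_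
  exact limsup_le_of_le (isBoundedUnder_ge_log_Mx ν r).isCoboundedUnder_le
    (eventually_log_Mx_div_le hd ν hr hq.le hS0 hS hq')

lemma hUpper_nonneg {d : ℕ} (hd : 0 < d) (ν : Measure (Ed d)) [IsProbabilityMeasure ν] {r : ℝ}
    (hr : 0 < r) : 0 ≤ hUpper d ν r := by
  refine le_limsup_of_frequently_le (Eventually.frequently ?_) (isBoundedUnder_le_log_Mx hd ν hr)
  filter_upwards [eventually_ge_atTop 1] with x hx using log_Mx_div_nonneg hx

lemma logPlus_nonneg (x : ℝ) : 0 ≤ logPlus x := Real.log_nonneg (le_max_right _ _)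

lemma Ncount_le_rpow {d : ℕ} (hd : 0 < d) (ν : Measure (Ed d)) [IsProbabilityMeasure ν] {r : ℝ}
    (hr : 0 < r) (α : ℝ) (n : ℕ) : (Ncount d ν α r n : ℝ) ≤ (2 : ℝ) ^ ((α - r) * n) := by
  have h : (Ncount d ν α r n : ℝ) * 2 ^ (-(α * n)) ≤ (2 : ℝ) ^ (-(r * n)) := by
    calc (Ncount d ν α r n : ℝ) * 2 ^ (-(α * n))
        ≤ ∑ k ∈ (idx d n).filter
            (fun k => (2:ℝ) ^ (-(α * (n:ℝ))) ≤ Jf d ν r (dyadicCube d n k)),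
            Jf d ν r (dyadicCube d n k) := by
          rw [Ncount, ← nsmul_eq_mul]
          exact Finset.card_nsmul_le_sum _ _ _ fun k hk => (Finset.mem_filter.1 hk).2
      _ ≤ ∑ k ∈ idx d n, Jf d ν r (dyadicCube d n k) :=
          Finset.sum_le_sum_of_subset_of_nonneg (Finset.filter_subset _ _)
            fun k _ _ => Jf_nonneg ν r _
      _ ≤ _ := sum_Jf_le hd ν hr n
  rw [Real.rpow_neg two_pos.le, ← div_eq_mul_inv, div_le_iff₀ (by positivity),
    ← Real.rpow_add two_pos] at h
  rwa [show (α - r) * n = -(r * n) + α * n by ring]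

lemma logPlus_Ncount_nonneg {d : ℕ} (ν : Measure (Ed d)) (r α : ℝ) (n : ℕ) :
    0 ≤ logPlus (Ncount d ν α r n) / (n * Real.log 2) :=
  div_nonneg (logPlus_nonneg _) (mul_nonneg n.cast_nonneg (Real.log_nonneg one_le_two))

lemma logPlus_Ncount_le {d : ℕ} (hd : 0 < d) (ν : Measure (Ed d)) [IsProbabilityMeasure ν] {r : ℝ}
    (hr : 0 < r) {α : ℝ} (hα : 0 < α) (n : ℕ) :
    logPlus (Ncount d ν α r n) / (n * Real.log 2) ≤ d / (d + r) * α := by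
  have hl2 := Real.log_pos one_lt_two
  refine div_le_of_le_mul₀ (by positivity) (by positivity) ?_
  rcases Nat.eq_zero_or_pos (Ncount d ν α r n) with h0 | h0
  · rw [h0, logPlus, Nat.cast_zero, max_eq_right zero_le_one, Real.log_one]
    positivity
  · have hN : (1 : ℝ) ≤ Ncount d ν α r n := by exact_mod_cast h0
    have h1 : Real.log (Ncount d ν α r n) ≤ (α - r) * n * Real.log 2 := by
      rw [← Real.log_rpow two_pos]
      exact Real.log_le_log (by positivity) (Ncount_le_rpow hd ν hr α n)
    have h2 : Real.log (Ncount d ν α r n) ≤ d * n * Real.log 2 := by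
      rw [← Nat.cast_mul, ← Real.log_pow]
      refine Real.log_le_log (by positivity) ?_
      have : Ncount d ν α r n ≤ 2 ^ (d * n) :=
        (Finset.card_le_card (Finset.filter_subset _ _)).trans_eq (card_idx d n)
      exact_mod_cast this
    rw [logPlus, max_eq_left hN]
    have hdr : (0 : ℝ) < d + r := by positivity
    rw [div_mul_eq_mul_div, div_mul_eq_mul_div, le_div_iff₀ hdr]
    have hd' : (0 : ℝ) < d := Nat.cast_pos.2 hd
    nlinarith

lemma FUpperAt_div_le {d : ℕ} (hd : 0 < d) (ν : Measure (Ed d)) [IsProbabilityMeasure ν] {r : ℝ}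
    (hr : 0 < r) {α : ℝ} (hα : 0 < α) : FUpperAt d ν r α / α ≤ d / (d + r) := by
  rw [div_le_iff₀ hα]
  exact limsup_le_of_le (isBoundedUnder_of_eventually_ge
    (Eventually.of_forall (logPlus_Ncount_nonneg ν r α))).isCoboundedUnder_le
    (Eventually.of_forall (logPlus_Ncount_le hd ν hr hα))

lemma isBoundedUnder_logPlus_Ncount {d : ℕ} (hd : 0 < d) (ν : Measure (Ed d))
    [IsProbabilityMeasure ν] {r : ℝ} (hr : 0 < r) {α : ℝ} (hα : 0 < α) :
    IsBoundedUnder (· ≤ ·) atTop fun n : ℕ =>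
      logPlus (Ncount d ν α r n) / (n * Real.log 2) :=
  isBoundedUnder_of_eventually_le (Eventually.of_forall (logPlus_Ncount_le hd ν hr hα))

lemma FUpperAt_div_le_FUpper {d : ℕ} (hd : 0 < d) (ν : Measure (Ed d)) [IsProbabilityMeasure ν]
    {r : ℝ} (hr : 0 < r) {α : ℝ} (hα : 0 < α) : FUpperAt d ν r α / α ≤ FUpper d ν r := by
  refine le_csSup ⟨d / (d + r), ?_⟩ ⟨α, hα, rfl⟩
  rintro v ⟨α, hα, rfl⟩
  exact FUpperAt_div_le hd ν hr hα

lemma FUpper_nonneg {d : ℕ} (hd : 0 < d) (ν : Measure (Ed d)) [IsProbabilityMeasure ν]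
    {r : ℝ} (hr : 0 < r) : 0 ≤ FUpper d ν r := by
  refine le_trans ?_ (FUpperAt_div_le_FUpper hd ν hr one_pos)
  rw [div_one]
  exact le_limsup_of_frequently_le (Frequently.of_forall (logPlus_Ncount_nonneg ν r 1))
    (isBoundedUnder_logPlus_Ncount hd ν hr one_pos)

lemma FUpper_lt_one {d : ℕ} (hd : 0 < d) (ν : Measure (Ed d)) [IsProbabilityMeasure ν]
    {r : ℝ} (hr : 0 < r) : FUpper d ν r < 1 := by
  have hd' : (0 : ℝ) < d := Nat.cast_pos.2 hd
  have hlt : (d : ℝ) / (d + r) < 1 := (div_lt_one (by positivity)).2 (by linarith)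
  refine lt_of_le_of_lt (csSup_le ⟨_, 1, one_pos, rfl⟩ ?_) hlt
  rintro v ⟨α, hα, rfl⟩
  exact FUpperAt_div_le hd ν hr hα

lemma eventually_Ncount_le {d : ℕ} (hd : 0 < d) (ν : Measure (Ed d)) [IsProbabilityMeasure ν]
    {r : ℝ} (hr : 0 < r) {s : ℝ} (hs : FUpper d ν r < s) {α : ℝ} (hα : 0 < α) :
    ∀ᶠ n in atTop, (Ncount d ν α r n : ℝ) ≤ (2 : ℝ) ^ (s * α * n) := by
  have h : FUpperAt d ν r α < s * α := by
    rw [← div_lt_iff₀ hα]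
    exact (FUpperAt_div_le_FUpper hd ν hr hα).trans_lt hs
  filter_upwards [eventually_lt_of_limsup_lt h (isBoundedUnder_logPlus_Ncount hd ν hr hα),
    eventually_gt_atTop 0] with n hn hn0
  have hn' : (0 : ℝ) < n * Real.log 2 :=
    mul_pos (Nat.cast_pos.2 hn0) (Real.log_pos one_lt_two)
  rw [div_lt_iff₀ hn', ← mul_assoc, ← Real.log_rpow two_pos] at hn
  exact (le_max_left _ _).trans
    ((Real.log_le_log_iff (by positivity) (by positivity)).1 hn.le)

/-- Decomposition of a number in `[0,1]` along powers of `b ≤ 1`. -/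
lemma rpow_le_layers {J b q : ℝ} (hJ0 : 0 ≤ J) (hJ1 : J ≤ 1) (hb : 0 ≤ b) (hq : 0 ≤ q) (K : ℕ) :
    J ^ q ≤ (b ^ K) ^ q + ∑ j ∈ Finset.range K, if b ^ (j + 1) ≤ J then (b ^ j) ^ q else 0 := by
  induction K with
  | zero => simpa using Real.rpow_le_one hJ0 hJ1 hq
  | succ K ih =>
    rw [Finset.sum_range_succ]
    split_ifs with h
    · have : 0 ≤ (b ^ (K + 1)) ^ q := by positivity
      linarith
    · have h1 : J ^ q ≤ (b ^ (K + 1)) ^ q := Real.rpow_le_rpow hJ0 (not_le.1 h).le hq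
      have h2 : 0 ≤ ∑ j ∈ Finset.range K, if b ^ (j + 1) ≤ J then (b ^ j) ^ q else 0 :=
        Finset.sum_nonneg fun j _ => by split_ifs <;> positivity
      linarith

lemma tauJ_neg_of_FUpper_lt {d : ℕ} (hd : 0 < d) (ν : Measure (Ed d)) [IsProbabilityMeasure ν]
    (hsupp : ν (Qcube d)ᶜ = 0) {r : ℝ} (hr : 0 < r) {q : ℝ} (hq : FUpper d ν r < q) :
    tauJ d ν r q < 0 := by
  have hF := FUpper_nonneg hd ν hr
  have hq0 : 0 < q := hF.trans_lt hq
  obtain ⟨s, hs, hsq⟩ := exists_between hq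
  have hs0 : 0 < s := hF.trans_lt hs
  set c := (q - s) * r / 2 with hc
  have hc0 : 0 < c := by have := sub_pos.2 hsq; positivity
  set δ := c / q with hδ
  have hδ0 : 0 < δ := by positivity
  have hqδ : q * δ = c := by rw [hδ]; field_simp
  obtain ⟨K, hK⟩ := exists_nat_ge ((d + c) / c)
  rw [div_le_iff₀ hc0] at hK
  have hev : ∀ᶠ n in atTop, ∀ j ∈ Finset.range K,
      (Ncount d ν ((j + 1) * δ) r n : ℝ) ≤ (2 : ℝ) ^ (s * ((j + 1) * δ) * n) :=
    (Finset.eventually_all _).2 fun j _ => eventually_Ncount_le hd ν hr hs (by positivity)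
  have hsum : ∀ᶠ n : ℕ in atTop,
      ∑ k ∈ idx d n, Jf d ν r (dyadicCube d n k) ^ q ≤ (K + 1) * (2 : ℝ) ^ (-(c * n)) := by
    filter_upwards [hev, eventually_gt_atTop 0] with n hn hn0
    have hn0' : (0 : ℝ) < n := Nat.cast_pos.2 hn0
    set b := (2 : ℝ) ^ (-(δ * n)) with hb
    have hbp : ∀ j : ℕ, b ^ j = (2 : ℝ) ^ (-(j * δ * n)) := fun j => by
      rw [hb, ← Real.rpow_natCast, ← Real.rpow_mul two_pos.le]; congr 1; ring
    calc ∑ k ∈ idx d n, Jf d ν r (dyadicCube d n k) ^ q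
        ≤ ∑ k ∈ idx d n, ((b ^ K) ^ q + ∑ j ∈ Finset.range K,
            if b ^ (j + 1) ≤ Jf d ν r (dyadicCube d n k) then (b ^ j) ^ q else 0) :=
          Finset.sum_le_sum fun k hk => rpow_le_layers (Jf_nonneg ν r _) (Jf_le_one hd ν hr hk)
            (by positivity) hq0.le K
      _ = 2 ^ (d * n) * (b ^ K) ^ q + ∑ j ∈ Finset.range K,
            Ncount d ν ((j + 1) * δ) r n * (b ^ j) ^ q := by
          rw [Finset.sum_add_distrib, Finset.sum_const, card_idx, nsmul_eq_mul, Finset.sum_comm]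
          push_cast
          congr 1
          refine Finset.sum_congr rfl fun j _ => ?_
          rw [← Finset.sum_filter, Finset.sum_const, nsmul_eq_mul, Ncount, hbp (j + 1)]
          push_cast
          rfl
      _ ≤ 2 ^ (-(c * n)) + ∑ j ∈ Finset.range K, (2 : ℝ) ^ (-(c * n)) := by
          refine add_le_add ?_ (Finset.sum_le_sum fun j hj => ?_)
          · rw [hbp, ← Real.rpow_mul two_pos.le, ← Real.rpow_natCast, ← Real.rpow_add two_pos]
            refine Real.rpow_le_rpow_of_exponent_le one_le_two ?_
            have h1 : -(K * δ * n) * q = -(K * (q * δ) * n) := by ring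
            rw [h1, hqδ]
            push_cast
            nlinarith
          · rw [hbp, ← Real.rpow_mul two_pos.le]
            rcases lt_or_ge ((j + 1) * δ) r with hlt | hge
            · have h1 := Ncount_le_rpow hd ν hr ((j + 1) * δ) n
              have h2 : (2 : ℝ) ^ (((j + 1) * δ - r) * n) < 1 :=
                Real.rpow_lt_one_of_one_lt_of_neg one_lt_two
                  (mul_neg_of_neg_of_pos (sub_neg.2 hlt) hn0')
              have h3 : Ncount d ν ((j + 1) * δ) r n = 0 := by
                have := h1.trans_lt h2
                rw [Nat.cast_lt_one] at this
                exact this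
              rw [h3, Nat.cast_zero, zero_mul]
              positivity
            · calc (Ncount d ν ((j + 1) * δ) r n : ℝ) * 2 ^ (-(j * δ * n) * q)
                  ≤ 2 ^ (s * ((j + 1) * δ) * n) * 2 ^ (-(j * δ * n) * q) := by
                    gcongr
                    exact hn j hj
                _ ≤ 2 ^ (-(c * n)) := by
                    rw [← Real.rpow_add two_pos]
                    refine Real.rpow_le_rpow_of_exponent_le one_le_two ?_
                    have h1 : s * ((j + 1) * δ) * n + -(j * δ * n) * q =
                        (q * δ - (q - s) * ((j + 1) * δ)) * n := by ring
                    have h2 : (q - s) * r ≤ (q - s) * ((j + 1) * δ) :=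
                      mul_le_mul_of_nonneg_left hge (sub_pos.2 hsq).le
                    rw [h1, hqδ, ← neg_mul]
                    refine mul_le_mul_of_nonneg_right ?_ hn0'.le
                    linarith
      _ = _ := by
          rw [Finset.sum_const, Finset.card_range, nsmul_eq_mul]; ring
  have hle : tauJ d ν r q ≤ -(c / 2) := by
    refine limsup_le_of_le (isBoundedUnder_of_eventually_ge
      (eventually_tauN_ge hd ν hsupp hr hq0)).isCoboundedUnder_le ?_
    obtain ⟨L, hL⟩ := exists_nat_ge (Real.log (K + 1) / (c / 2 * Real.log 2))
    have hl2 := Real.log_pos one_lt_two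
    rw [div_le_iff₀ (by positivity)] at hL
    filter_upwards [hsum, eventually_gt_atTop 0, eventually_ge_atTop L] with n hn hn0 hnL
    have hn' : (0 : ℝ) < n * Real.log 2 := mul_pos (Nat.cast_pos.2 hn0) hl2
    have hpos := (by positivity : (0 : ℝ) < 2 ^ (-((d + r) * q * n))).trans_le
      (le_sum_Jf_rpow hd ν hsupp hr hq0 n)
    have h1 := Real.log_le_log hpos hn
    rw [Real.log_mul (by positivity) (by positivity), Real.log_rpow two_pos] at h1
    rw [tauN_eq ν r hq0, div_le_iff₀ hn']
    have h2 : (L : ℝ) * (c / 2 * Real.log 2) ≤ n * (c / 2 * Real.log 2) := by gcongr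
    linarith
  linarith

lemma qrCrit_le_FUpper {d : ℕ} (hd : 0 < d) (ν : Measure (Ed d)) [IsProbabilityMeasure ν]
    (hsupp : ν (Qcube d)ᶜ = 0) {r : ℝ} (hr : 0 < r) : qrCrit d ν r ≤ FUpper d ν r := by
  refine le_of_forall_gt_imp_ge_of_dense fun q hq => csInf_le ⟨0, fun _ h => h.1.le⟩ ⟨?_, ?_⟩
  · exact (FUpper_nonneg hd ν hr).trans_lt hq
  · exact tauJ_neg_of_FUpper_lt hd ν hsupp hr hq

lemma hUpper_le_qrCrit {d : ℕ} (hd : 0 < d) (ν : Measure (Ed d)) [IsProbabilityMeasure ν]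
    (hsupp : ν (Qcube d)ᶜ = 0) {r : ℝ} (hr : 0 < r) : hUpper d ν r ≤ qrCrit d ν r := by
  refine le_csInf ⟨1, one_pos, tauJ_neg_of_FUpper_lt hd ν hsupp hr (FUpper_lt_one hd ν hr)⟩ ?_
  rintro q ⟨hq, hτ⟩
  exact hUpper_le_of_tauJ_neg hd ν hsupp hr hq hτ

lemma quantRatio_le_of_Mx_le {d : ℕ} (hd : 0 < d) (ν : Measure (Ed d)) [IsProbabilityMeasure ν]
    (hsupp : ν (Qcube d)ᶜ = 0) {r : ℝ} (hr : 0 < r) {x q : ℝ} (hx : 1 < x) (hq0 : 0 < q)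
    (hq1 : q < 1) {N : ℕ} (hM : Mx d ν r x ≤ N) (hN : (N : ℝ) ≤ x ^ q) :
    Real.log N / (-Real.log (qerr d ν N r)) ≤ r * q / (1 - q) ∧ qerr d ν N r < 1 := by
  have hx0 : 0 < x := one_pos.trans hx
  obtain ⟨P, hP, hJ, hcard⟩ := exists_partition_card_eq_Mx hd ν hr hx.le
  have hN1 : (1 : ℝ) ≤ N := Nat.one_le_cast.2 ((one_le_Mx hd ν hr hx.le).trans hM)
  have hlogx := Real.log_pos hx
  have hq1' := sub_pos.2 hq1
  have he : qerr d ν N r ^ r ≤ x ^ (q - 1) := by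
    refine (qerr_rpow_le hd ν hsupp hr hx0 hP hJ (hcard.trans_le hM)).trans ?_
    rw [Real.rpow_sub_one hx0.ne']
    gcongr
  have hlt : qerr d ν N r < 1 := by
    by_contra! h
    have h1 := (Real.one_le_rpow h hr.le).trans he
    exact h1.not_gt (Real.rpow_lt_one_of_one_lt_of_neg hx (by linarith))
  refine ⟨?_, hlt⟩
  rcases (qerr_nonneg ν N r).eq_or_lt with h0 | h0
  · rw [← h0, Real.log_zero, neg_zero, div_zero]
    positivity
  · have h1 := Real.log_le_log (by positivity) he
    rw [Real.log_rpow h0, Real.log_rpow hx0] at h1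
    have h2 := Real.log_le_log (by positivity) hN
    rw [Real.log_rpow hx0] at h2
    rw [div_le_iff₀ (neg_pos.2 (Real.log_neg h0 hlt))]
    calc Real.log N ≤ q * Real.log x := h2
      _ = q / (1 - q) * ((1 - q) * Real.log x) := by field_simp
      _ ≤ q / (1 - q) * (r * -Real.log (qerr d ν N r)) :=
          mul_le_mul_of_nonneg_left (by linarith) (by positivity)
      _ = _ := by ring

lemma Mx_le_rpow_of_log_div_lt {d : ℕ} {ν : Measure (Ed d)} {r x q : ℝ} (hx : 1 < x)
    (h : Real.log (Mx d ν r x) / Real.log x < q) (hM : 0 < Mx d ν r x) :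
    (Mx d ν r x : ℝ) ≤ x ^ q := by
  have hx0 : 0 < x := one_pos.trans hx
  rw [div_lt_iff₀ (Real.log_pos hx), ← Real.log_rpow hx0] at h
  exact (Real.log_le_log_iff (Nat.cast_pos.2 hM) (by positivity)).1 h.le

lemma eventually_quantRatio_le {d : ℕ} (hd : 0 < d) (ν : Measure (Ed d)) [IsProbabilityMeasure ν]
    (hsupp : ν (Qcube d)ᶜ = 0) {r : ℝ} (hr : 0 < r) {q : ℝ} (hq : hUpper d ν r < q)
    (hq1 : q < 1) :
    ∀ᶠ N : ℕ in atTop, Real.log N / (-Real.log (qerr d ν N r)) ≤ r * q / (1 - q) ∧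
      qerr d ν N r < 1 := by
  have hq0 : 0 < q := (hUpper_nonneg hd ν hr).trans_lt hq
  have htend : Tendsto (fun N : ℕ => (N : ℝ) ^ q⁻¹) atTop atTop :=
    (tendsto_rpow_atTop (inv_pos.2 hq0)).comp tendsto_natCast_atTop_atTop
  filter_upwards [htend.eventually (eventually_lt_of_limsup_lt hq
    (isBoundedUnder_le_log_Mx hd ν hr)), htend.eventually (eventually_gt_atTop 1)] with N h1 h2
  have hNq : ((N : ℝ) ^ q⁻¹) ^ q = N := Real.rpow_inv_rpow N.cast_nonneg hq0.ne'
  have h3 := Mx_le_rpow_of_log_div_lt h2 h1 (one_le_Mx hd ν hr h2.le)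
  rw [hNq, Nat.cast_le] at h3
  exact quantRatio_le_of_Mx_le hd ν hsupp hr h2 hq0 hq1 h3 hNq.ge

lemma frequently_quantRatio_le {d : ℕ} (hd : 0 < d) (ν : Measure (Ed d)) [IsProbabilityMeasure ν]
    (hsupp : ν (Qcube d)ᶜ = 0) {r : ℝ} (hr : 0 < r) {q : ℝ} (hq : hLowerBase d ν r < q)
    (hq0 : 0 < q) (hq1 : q < 1) :
    ∃ᶠ N : ℕ in atTop, Real.log N / (-Real.log (qerr d ν N r)) ≤ r * q / (1 - q) := by
  have hfreq := frequently_lt_of_liminf_lt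
    (isBoundedUnder_le_log_Mx hd ν hr).isCoboundedUnder_ge hq
  have htend : Tendsto (fun x : ℝ => ⌊x ^ q⌋₊) atTop atTop :=
    tendsto_nat_floor_atTop.comp (tendsto_rpow_atTop hq0)
  refine htend.frequently ((hfreq.and_eventually (eventually_gt_atTop 1)).mono ?_)
  rintro x ⟨h1, h2⟩
  have h3 := Mx_le_rpow_of_log_div_lt h2 h1 (one_le_Mx hd ν hr h2.le)
  exact (quantRatio_le_of_Mx_le hd ν hsupp hr h2 hq0 hq1 (Nat.le_floor h3)
    (Nat.floor_le (by positivity))).1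

lemma hUpper_lt_one {d : ℕ} (hd : 0 < d) (ν : Measure (Ed d)) [IsProbabilityMeasure ν]
    (hsupp : ν (Qcube d)ᶜ = 0) {r : ℝ} (hr : 0 < r) : hUpper d ν r < 1 :=
  (hUpper_le_qrCrit hd ν hsupp hr).trans_lt
    ((qrCrit_le_FUpper hd ν hsupp hr).trans_lt (FUpper_lt_one hd ν hr))

lemma eventually_qerr_lt_one {d : ℕ} (hd : 0 < d) (ν : Measure (Ed d)) [IsProbabilityMeasure ν]
    (hsupp : ν (Qcube d)ᶜ = 0) {r : ℝ} (hr : 0 < r) :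
    ∀ᶠ N : ℕ in atTop, qerr d ν N r < 1 := by
  obtain ⟨q, hq, hq1⟩ := exists_between (hUpper_lt_one hd ν hsupp hr)
  exact (eventually_quantRatio_le hd ν hsupp hr hq hq1).mono fun _ h => h.2

lemma eventually_quantRatio_nonneg {d : ℕ} (hd : 0 < d) (ν : Measure (Ed d))
    [IsProbabilityMeasure ν] (hsupp : ν (Qcube d)ᶜ = 0) {r : ℝ} (hr : 0 < r) :
    ∀ᶠ N : ℕ in atTop, 0 ≤ Real.log N / (-Real.log (qerr d ν N r)) :=
  (eventually_qerr_lt_one hd ν hsupp hr).mono fun N h => div_nonneg (Real.log_natCast_nonneg N)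
    (neg_nonneg.2 (Real.log_nonpos (qerr_nonneg ν N r) h.le))

lemma isBoundedUnder_le_quantRatio {d : ℕ} (hd : 0 < d) (ν : Measure (Ed d))
    [IsProbabilityMeasure ν] (hsupp : ν (Qcube d)ᶜ = 0) {r : ℝ} (hr : 0 < r) :
    IsBoundedUnder (· ≤ ·) atTop fun N : ℕ => Real.log N / (-Real.log (qerr d ν N r)) := by
  obtain ⟨q, hq, hq1⟩ := exists_between (hUpper_lt_one hd ν hsupp hr)
  exact isBoundedUnder_of_eventually_le
    ((eventually_quantRatio_le hd ν hsupp hr hq hq1).mono fun _ h => h.1)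

lemma isBoundedUnder_ge_quantRatio {d : ℕ} (hd : 0 < d) (ν : Measure (Ed d))
    [IsProbabilityMeasure ν] (hsupp : ν (Qcube d)ᶜ = 0) {r : ℝ} (hr : 0 < r) :
    IsBoundedUnder (· ≥ ·) atTop fun N : ℕ => Real.log N / (-Real.log (qerr d ν N r)) :=
  isBoundedUnder_of_eventually_ge (eventually_quantRatio_nonneg hd ν hsupp hr)

lemma lowerD_nonneg {d : ℕ} (hd : 0 < d) (ν : Measure (Ed d)) [IsProbabilityMeasure ν]
    (hsupp : ν (Qcube d)ᶜ = 0) {r : ℝ} (hr : 0 < r) : 0 ≤ lowerD d ν r :=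
  le_liminf_of_le (isBoundedUnder_le_quantRatio hd ν hsupp hr).isCoboundedUnder_ge
    (eventually_quantRatio_nonneg hd ν hsupp hr)

lemma lowerD_le_upperD {d : ℕ} (hd : 0 < d) (ν : Measure (Ed d)) [IsProbabilityMeasure ν]
    (hsupp : ν (Qcube d)ᶜ = 0) {r : ℝ} (hr : 0 < r) : lowerD d ν r ≤ upperD d ν r :=
  liminf_le_limsup (isBoundedUnder_le_quantRatio hd ν hsupp hr)
    (isBoundedUnder_ge_quantRatio hd ν hsupp hr)

/-- `u ↦ r u / (1 - u)` and `D ↦ D / (r + D)` are inverse order isomorphisms. -/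
lemma le_mul_div_one_sub_iff {r D u : ℝ} (hr : 0 < r) (hD : 0 ≤ D) (hu : u < 1) :
    D ≤ r * u / (1 - u) ↔ D / (r + D) ≤ u := by
  rw [le_div_iff₀ (sub_pos.2 hu), div_le_iff₀ (by positivity)]
  constructor <;> intro h <;> linarith

lemma mul_div_one_sub_le_iff {r D u : ℝ} (hr : 0 < r) (hD : 0 ≤ D) (hu : u < 1) :
    r * u / (1 - u) ≤ D ↔ u ≤ D / (r + D) := by
  rw [div_le_iff₀ (sub_pos.2 hu), le_div_iff₀ (by positivity)]
  constructor <;> intro h <;> linarith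

lemma mul_div_one_sub_mono {r u v : ℝ} (hr : 0 < r) (huv : u ≤ v) (hv : v < 1) :
    r * u / (1 - u) ≤ r * v / (1 - v) := by
  rw [div_le_div_iff₀ (sub_pos.2 (huv.trans_lt hv)) (sub_pos.2 hv)]
  linarith [mul_le_mul_of_nonneg_left huv hr.le]

lemma upperD_div_le_hUpper {d : ℕ} (hd : 0 < d) (ν : Measure (Ed d)) [IsProbabilityMeasure ν]
    (hsupp : ν (Qcube d)ᶜ = 0) {r : ℝ} (hr : 0 < r) :
    upperD d ν r / (r + upperD d ν r) ≤ hUpper d ν r := by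
  have hD := (lowerD_nonneg hd ν hsupp hr).trans (lowerD_le_upperD hd ν hsupp hr)
  refine le_of_forall_gt_imp_ge_of_dense fun q hq => ?_
  rcases lt_or_ge q 1 with hq1 | hq1
  · rw [← le_mul_div_one_sub_iff hr hD hq1]
    exact limsup_le_of_le (isBoundedUnder_ge_quantRatio hd ν hsupp hr).isCoboundedUnder_le
      ((eventually_quantRatio_le hd ν hsupp hr hq hq1).mono fun _ h => h.1)
  · exact ((div_le_one (by positivity)).2 (by linarith)).trans hq1

lemma hLowerBase_nonneg {d : ℕ} (hd : 0 < d) (ν : Measure (Ed d)) [IsProbabilityMeasure ν] {r : ℝ}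
    (hr : 0 < r) : 0 ≤ hLowerBase d ν r := by
  refine le_liminf_of_le (isBoundedUnder_le_log_Mx hd ν hr).isCoboundedUnder_ge ?_
  filter_upwards [eventually_ge_atTop 1] with x hx using log_Mx_div_nonneg hx

lemma hLowerBase_le_hUpper {d : ℕ} (hd : 0 < d) (ν : Measure (Ed d)) [IsProbabilityMeasure ν]
    {r : ℝ} (hr : 0 < r) : hLowerBase d ν r ≤ hUpper d ν r :=
  liminf_le_limsup (isBoundedUnder_le_log_Mx hd ν hr) (isBoundedUnder_ge_log_Mx ν r)

lemma lowerD_div_le_hLowerBase {d : ℕ} (hd : 0 < d) (ν : Measure (Ed d)) [IsProbabilityMeasure ν]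
    (hsupp : ν (Qcube d)ᶜ = 0) {r : ℝ} (hr : 0 < r) :
    lowerD d ν r / (r + lowerD d ν r) ≤ hLowerBase d ν r := by
  have hD := lowerD_nonneg hd ν hsupp hr
  refine le_of_forall_gt_imp_ge_of_dense fun q hq => ?_
  rcases lt_or_ge q 1 with hq1 | hq1
  · rw [← le_mul_div_one_sub_iff hr hD hq1]
    exact liminf_le_of_frequently_le (frequently_quantRatio_le hd ν hsupp hr hq
      ((hLowerBase_nonneg hd ν hr).trans_lt hq) hq1) (isBoundedUnder_ge_quantRatio hd ν hsupp hr)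
  · exact ((div_le_one (by positivity)).2 (by linarith)).trans hq1

lemma Jf_antitone_order {d : ℕ} (hd : 0 < d) (ν : Measure (Ed d)) [IsProbabilityMeasure ν]
    {r r' : ℝ} (hr : 0 < r) (hrr' : r ≤ r') {Q : Set (Ed d)} (hQ : Q ∈ Ddy d) :
    Jf d ν r' Q ≤ Jf d ν r Q := by
  obtain ⟨n, k, hk, rfl⟩ := mem_Ddy_iff.1 hQ
  rw [Jf_dyadicCube hd ν hr hk, Jf_dyadicCube hd ν (hr.trans_le hrr') hk]
  gcongr
  exact one_le_two

lemma Mx_antitone_order {d : ℕ} (hd : 0 < d) (ν : Measure (Ed d)) [IsProbabilityMeasure ν]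
    {r r' : ℝ} (hr : 0 < r) (hrr' : r ≤ r') {x : ℝ} (hx : 1 ≤ x) :
    Mx d ν r' x ≤ Mx d ν r x := by
  obtain ⟨P, hP, hJ, hcard⟩ := exists_partition_card_eq_Mx hd ν hr hx
  rw [← hcard]
  exact Mx_le_card hP fun Q hQ => (Jf_antitone_order hd ν hr hrr' (hP.1 Q hQ)).trans_lt (hJ Q hQ)

lemma hLowerBase_antitone {d : ℕ} (hd : 0 < d) (ν : Measure (Ed d)) [IsProbabilityMeasure ν]
    {r r' : ℝ} (hr : 0 < r) (hrr' : r ≤ r') : hLowerBase d ν r' ≤ hLowerBase d ν r := by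
  refine liminf_le_liminf ?_ (isBoundedUnder_ge_log_Mx ν r')
    (isBoundedUnder_le_log_Mx hd ν hr).isCoboundedUnder_ge
  filter_upwards [eventually_ge_atTop 1] with x hx
  have h1 : (0 : ℝ) < Mx d ν r' x := Nat.cast_pos.2 (one_le_Mx hd ν (hr.trans_le hrr') hx)
  have h2 : (Mx d ν r' x : ℝ) ≤ Mx d ν r x := Nat.cast_le.2 (Mx_antitone_order hd ν hr hrr' hx)
  have := Real.log_nonneg hx
  gcongr

lemma hLowerLim_eq {d : ℕ} (hd : 0 < d) (ν : Measure (Ed d)) [IsProbabilityMeasure ν]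
    {r : ℝ} (hr : 0 < r) :
    hLowerLim d ν r = sInf ((fun ε => hLowerBase d ν (r - ε)) '' Ioo 0 r) ∧
      ∀ ε ∈ Ioo 0 r, hLowerBase d ν r ≤ hLowerBase d ν (r - ε) := by
  have hmono : MonotoneOn (fun ε => hLowerBase d ν (r - ε)) (Ioo 0 r) := fun a _ b hb hab =>
    hLowerBase_antitone hd ν (sub_pos.2 hb.2) (by linarith)
  have hbd : ∀ ε ∈ Ioo 0 r, hLowerBase d ν r ≤ hLowerBase d ν (r - ε) := fun ε hε =>
    hLowerBase_antitone hd ν (sub_pos.2 hε.2) (by linarith [hε.1])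
  refine ⟨Tendsto.limUnder_eq
    (hmono.tendsto_nhdsWithin_Ioo_right ⟨r / 2, by constructor <;> linarith⟩ ?_), hbd⟩
  exact ⟨_, forall_mem_image.2 hbd⟩

lemma hLowerBase_le_hLowerLim {d : ℕ} (hd : 0 < d) (ν : Measure (Ed d)) [IsProbabilityMeasure ν]
    {r : ℝ} (hr : 0 < r) : hLowerBase d ν r ≤ hLowerLim d ν r := by
  obtain ⟨h1, h2⟩ := hLowerLim_eq hd ν hr
  rw [h1]
  exact le_csInf ((nonempty_Ioo.2 hr).image _) (forall_mem_image.2 h2)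

lemma tauN_sub {d : ℕ} (hd : 0 < d) (ν : Measure (Ed d)) [IsProbabilityMeasure ν]
    (hsupp : ν (Qcube d)ᶜ = 0) {r r' q : ℝ} (hr : 0 < r) (hr' : 0 < r') (hq : 0 < q) {n : ℕ}
    (hn : 0 < n) : tauN d ν r' q n = tauN d ν r q n + (r - r') * q := by
  have hn' : (0 : ℝ) < n * Real.log 2 := mul_pos (Nat.cast_pos.2 hn) (Real.log_pos one_lt_two)
  have hsum : ∑ k ∈ idx d n, Jf d ν r' (dyadicCube d n k) ^ q =
      2 ^ ((r - r') * q * n) * ∑ k ∈ idx d n, Jf d ν r (dyadicCube d n k) ^ q := by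
    rw [Finset.mul_sum]
    refine Finset.sum_congr rfl fun k hk => ?_
    rw [Jf_dyadicCube hd ν hr hk, Jf_dyadicCube hd ν hr' hk,
      Real.mul_rpow ENNReal.toReal_nonneg (by positivity),
      Real.mul_rpow ENNReal.toReal_nonneg (by positivity), mul_left_comm,
      ← Real.rpow_mul two_pos.le, ← Real.rpow_mul two_pos.le, ← Real.rpow_add two_pos]
    congr 2
    ring
  have hpos := (by positivity : (0 : ℝ) < 2 ^ (-((d + r) * q * n))).trans_le
    (le_sum_Jf_rpow hd ν hsupp hr hq n)
  rw [tauN_eq ν r hq, tauN_eq ν r' hq, hsum, Real.log_mul (by positivity) hpos.ne',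
    Real.log_rpow two_pos]
  field_simp
  ring

/-- Negativity of the spectrum of `J` is stable under a small decrease of the order. -/
lemma exists_tauJ_sub_neg {d : ℕ} (hd : 0 < d) (ν : Measure (Ed d)) [IsProbabilityMeasure ν]
    (hsupp : ν (Qcube d)ᶜ = 0) {r : ℝ} (hr : 0 < r) {q : ℝ} (hq : 0 < q)
    (hτ : tauJ d ν r q < 0) : ∃ ε ∈ Ioo 0 r, tauJ d ν (r - ε) q < 0 := by
  obtain ⟨c, hc1, hc0⟩ := exists_between hτ
  obtain ⟨ε, hε0, hε⟩ := exists_between (lt_min hr (div_pos (neg_pos.2 hc0) (by positivity :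
    0 < 2 * q)))
  obtain ⟨hεr, hεq⟩ := lt_min_iff.1 hε
  refine ⟨ε, ⟨hε0, hεr⟩, ?_⟩
  rw [lt_div_iff₀ (by positivity)] at hεq
  have hrε := sub_pos.2 hεr
  have hle : tauJ d ν (r - ε) q ≤ c / 2 := by
    refine limsup_le_of_le (isBoundedUnder_of_eventually_ge
      (eventually_tauN_ge hd ν hsupp hrε hq)).isCoboundedUnder_le ?_
    filter_upwards [eventually_lt_of_limsup_lt hc1 (isBoundedUnder_of_eventually_le
      (eventually_tauN_le hd ν hsupp hr hq)), eventually_gt_atTop 0] with n hn hn0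
    rw [tauN_sub hd ν hsupp hr hrε hq hn0]
    linarith
  linarith

lemma hLowerLim_le_qrCrit {d : ℕ} (hd : 0 < d) (ν : Measure (Ed d)) [IsProbabilityMeasure ν]
    (hsupp : ν (Qcube d)ᶜ = 0) {r : ℝ} (hr : 0 < r) : hLowerLim d ν r ≤ qrCrit d ν r := by
  refine le_csInf ⟨1, one_pos, tauJ_neg_of_FUpper_lt hd ν hsupp hr (FUpper_lt_one hd ν hr)⟩ ?_
  rintro q ⟨hq, hτ⟩
  obtain ⟨ε, hε, hτε⟩ := exists_tauJ_sub_neg hd ν hsupp hr hq hτ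
  obtain ⟨h1, h2⟩ := hLowerLim_eq hd ν hr
  have hrε := sub_pos.2 hε.2
  rw [h1]
  exact (csInf_le ⟨_, forall_mem_image.2 h2⟩ (mem_image_of_mem _ hε)).trans
    ((hLowerBase_le_hUpper hd ν hrε).trans (hUpper_le_of_tauJ_neg hd ν hsupp hrε hq hτε))

/-- The lower bound for the quantization ratio coming from many cubes of large mass. -/
def coarseBound (d : ℕ) (r t α : ℝ) (m : ℕ) : ℝ :=
  r * Real.log m /
    ((α - t) / t * (Real.log m + Real.log (2 * (2 * 3 ^ d) * 2 ^ t)) + Real.log 2)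

lemma tendsto_coarseBound (d : ℕ) {r t α : ℝ} (ht : 0 < t) (htα : t < α) :
    Tendsto (coarseBound d r t α) atTop (𝓝 (r * t / (α - t))) := by
  have hαt := sub_pos.2 htα
  have hlog : Tendsto (fun m : ℕ => Real.log m) atTop atTop :=
    Real.tendsto_log_atTop.comp tendsto_natCast_atTop_atTop
  set B := (α - t) / t * Real.log (2 * (2 * 3 ^ d) * 2 ^ t) + Real.log 2 with hB
  have h1 : Tendsto (fun m : ℕ => r / ((α - t) / t + B / Real.log m)) atTop
      (𝓝 (r / ((α - t) / t + 0))) :=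
    tendsto_const_nhds.div (tendsto_const_nhds.add (tendsto_const_nhds.div_atTop hlog))
      (by positivity)
  have h2 : r / ((α - t) / t + 0) = r * t / (α - t) := by rw [add_zero]; field_simp
  rw [h2] at h1
  refine h1.congr' ?_
  filter_upwards [hlog.eventually_gt_atTop 0] with m hm
  rw [coarseBound, mul_add, add_assoc, ← hB, ← mul_div_mul_right r _ hm.ne', add_mul,
    div_mul_cancel₀ _ hm.ne']

lemma coarseBound_le {d : ℕ} (hd : 0 < d) (ν : Measure (Ed d)) [IsProbabilityMeasure ν]
    (hsupp : ν (Qcube d)ᶜ = 0) {r : ℝ} (hr : 0 < r) {t α : ℝ} (ht : 0 < t) (htα : t < α)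
    {n m : ℕ} (hm : 0 < m) (hN : (2 : ℝ) ^ (t * n) ≤ Ncount d ν α r n)
    (hmn : 2 * 3 ^ d * (m : ℝ) ≤ 2 ^ (t * n))
    (hnm : (2 : ℝ) ^ (t * n) ≤ 2 * (2 * 3 ^ d) * 2 ^ t * m) (hq : qerr d ν m r < 1) :
    coarseBound d r t α m ≤ Real.log m / (-Real.log (qerr d ν m r)) := by
  have hm' : (0 : ℝ) < m := Nat.cast_pos.2 hm
  have hNm : 2 * 3 ^ d * m ≤ Ncount d ν α r n := by exact_mod_cast hmn.trans hN
  have h1 : (2 : ℝ) ^ (t * n) / 2 * 2 ^ (-(α * n)) ≤ qerr d ν m r ^ r :=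
    le_trans (by gcongr) (Ncount_le_qerr_rpow hd ν hsupp hr hm hNm)
  have hpos : 0 < qerr d ν m r := by
    refine (qerr_nonneg ν m r).lt_of_ne fun h => ?_
    rw [← h, Real.zero_rpow hr.ne'] at h1
    exact h1.not_gt (by positivity)
  have h2 := Real.log_le_log (by positivity) h1
  rw [Real.log_mul (by positivity) (by positivity), Real.log_div (by positivity) two_ne_zero,
    Real.log_rpow two_pos, Real.log_rpow two_pos, Real.log_rpow hpos] at h2
  have h3 := Real.log_le_log (by positivity) hnm
  rw [Real.log_mul (by positivity) hm'.ne', Real.log_rpow two_pos] at h3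
  have hαt := sub_pos.2 htα
  have h4 : r * -Real.log (qerr d ν m r) ≤
      (α - t) / t * (Real.log m + Real.log (2 * (2 * 3 ^ d) * 2 ^ t)) + Real.log 2 := by
    calc r * -Real.log (qerr d ν m r) ≤ (α - t) / t * (t * n * Real.log 2) + Real.log 2 := by
          rw [div_mul_eq_mul_div, mul_div_assoc]
          have : t * n * Real.log 2 / t = n * Real.log 2 := by field_simp
          rw [this]
          linarith
      _ ≤ _ := by
          gcongr
          linarith
  have hlogq : 0 < -Real.log (qerr d ν m r) := neg_pos.2 (Real.log_neg hpos hq)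
  rw [coarseBound, ← mul_div_mul_left (Real.log m) _ hr.ne']
  exact div_le_div_of_nonneg_left (mul_nonneg hr.le (Real.log_natCast_nonneg m))
    (by positivity) h4

lemma rpow_le_Ncount {d : ℕ} {ν : Measure (Ed d)} {r t α : ℝ} (ht : 0 < t) {n : ℕ} (hn : 0 < n)
    (h : t < logPlus (Ncount d ν α r n) / (n * Real.log 2)) :
    (2 : ℝ) ^ (t * n) ≤ Ncount d ν α r n := by
  have hn0 : (0 : ℝ) < n := Nat.cast_pos.2 hn
  have hn' : (0 : ℝ) < n * Real.log 2 := mul_pos hn0 (Real.log_pos one_lt_two)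
  rw [lt_div_iff₀ hn', ← mul_assoc, ← Real.log_rpow two_pos] at h
  have h1 := (Real.log_le_log_iff (by positivity) (by positivity)).1 h.le
  exact (le_max_iff.1 h1).resolve_right
    (not_le.2 (Real.one_lt_rpow one_lt_two (by positivity)))

lemma FUpperAt_lt {d : ℕ} (hd : 0 < d) (ν : Measure (Ed d)) [IsProbabilityMeasure ν]
    {r : ℝ} (hr : 0 < r) {α : ℝ} (hα : 0 < α) : FUpperAt d ν r α < α := by
  rw [← div_lt_one hα]
  exact (FUpperAt_div_le_FUpper hd ν hr hα).trans_lt (FUpper_lt_one hd ν hr)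

lemma FLowerAt_le_FUpperAt {d : ℕ} (hd : 0 < d) (ν : Measure (Ed d)) [IsProbabilityMeasure ν]
    {r : ℝ} (hr : 0 < r) {α : ℝ} (hα : 0 < α) : FLowerAt d ν r α ≤ FUpperAt d ν r α :=
  liminf_le_limsup (isBoundedUnder_logPlus_Ncount hd ν hr hα)
    (isBoundedUnder_of_eventually_ge (Eventually.of_forall (logPlus_Ncount_nonneg ν r α)))

lemma mul_div_sub_le_upperD {d : ℕ} (hd : 0 < d) (ν : Measure (Ed d)) [IsProbabilityMeasure ν]
    (hsupp : ν (Qcube d)ᶜ = 0) {r : ℝ} (hr : 0 < r) {t α : ℝ} (hα : 0 < α) (ht : 0 < t)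
    (htF : t < FUpperAt d ν r α) : r * t / (α - t) ≤ upperD d ν r := by
  have htα := htF.trans (FUpperAt_lt hd ν hr hα)
  have hfreq := frequently_lt_of_lt_limsup (isBoundedUnder_of_eventually_ge
    (Eventually.of_forall (logPlus_Ncount_nonneg ν r α))).isCoboundedUnder_le htF
  have htend : Tendsto (fun n : ℕ => ⌊(2 : ℝ) ^ (t * n) / (2 * 3 ^ d)⌋₊) atTop atTop := by
    refine tendsto_nat_floor_atTop.comp (Tendsto.atTop_div_const (by positivity) ?_)
    exact (tendsto_rpow_atTop_of_base_gt_one 2 one_lt_two).comp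
      (tendsto_natCast_atTop_atTop.const_mul_atTop ht)
  have hf : ∃ᶠ m : ℕ in atTop,
      coarseBound d r t α m ≤ Real.log m / (-Real.log (qerr d ν m r)) := by
    refine htend.frequently ((hfreq.and_eventually ((eventually_gt_atTop 0).and
      ((htend.eventually (eventually_gt_atTop 0)).and
        (htend.eventually (eventually_qerr_lt_one hd ν hsupp hr))))).mono ?_)
    rintro n ⟨hn, hn0, hm, hq⟩
    have h1 := Nat.floor_le (by positivity : (0 : ℝ) ≤ (2 : ℝ) ^ (t * n) / (2 * 3 ^ d))
    have h2 := Nat.lt_floor_add_one ((2 : ℝ) ^ (t * n) / (2 * 3 ^ d))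
    set m := ⌊(2 : ℝ) ^ (t * n) / (2 * 3 ^ d)⌋₊
    have hm1 : (1 : ℝ) ≤ m := Nat.one_le_cast.2 hm
    rw [le_div_iff₀' (by positivity)] at h1
    rw [div_lt_iff₀' (by positivity)] at h2
    refine coarseBound_le hd ν hsupp hr ht htα hm (rpow_le_Ncount ht hn0 hn) h1 ?_ hq
    have h3 : (1 : ℝ) ≤ 2 ^ t := Real.one_le_rpow one_le_two ht.le
    calc (2 : ℝ) ^ (t * n) ≤ 2 * 3 ^ d * (m + 1) := h2.le
      _ ≤ 2 * 3 ^ d * (2 * m) := by gcongr; linarith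
      _ = 2 * (2 * 3 ^ d) * 1 * m := by ring
      _ ≤ _ := by gcongr
  refine le_of_forall_lt_imp_le_of_dense fun s hs => ?_
  refine le_limsup_of_frequently_le ?_ (isBoundedUnder_le_quantRatio hd ν hsupp hr)
  exact (hf.and_eventually ((tendsto_coarseBound d ht htα).eventually_const_le hs)).mono
    fun m h => h.2.trans h.1

lemma mul_div_sub_le_lowerD {d : ℕ} (hd : 0 < d) (ν : Measure (Ed d)) [IsProbabilityMeasure ν]
    (hsupp : ν (Qcube d)ᶜ = 0) {r : ℝ} (hr : 0 < r) {t α : ℝ} (hα : 0 < α) (ht : 0 < t)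
    (htF : t < FLowerAt d ν r α) : r * t / (α - t) ≤ lowerD d ν r := by
  have htα := htF.trans_le
    ((FLowerAt_le_FUpperAt hd ν hr hα).trans (FUpperAt_lt hd ν hr hα).le)
  have hev := eventually_lt_of_lt_liminf htF (isBoundedUnder_of_eventually_ge
    (Eventually.of_forall (logPlus_Ncount_nonneg ν r α)))
  have htend : Tendsto (fun m : ℕ => ⌈Real.logb 2 (2 * 3 ^ d * m) / t⌉₊) atTop atTop := by
    refine tendsto_nat_ceil_atTop.comp (Tendsto.atTop_div_const ht ?_)
    exact (Real.tendsto_logb_atTop one_lt_two).comp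
      (tendsto_natCast_atTop_atTop.const_mul_atTop (by positivity))
  have hf : ∀ᶠ m : ℕ in atTop,
      coarseBound d r t α m ≤ Real.log m / (-Real.log (qerr d ν m r)) := by
    filter_upwards [htend.eventually hev, htend.eventually (eventually_gt_atTop 0),
      eventually_gt_atTop 0, eventually_qerr_lt_one hd ν hsupp hr] with m hn hn0 hm hq
    have hm1 : (1 : ℝ) ≤ m := Nat.one_le_cast.2 hm
    have hKm : (1 : ℝ) ≤ 2 * 3 ^ d * m := by
      have : (1 : ℝ) ≤ 3 ^ d := one_le_pow₀ (by norm_num)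
      nlinarith
    have hl0 : 0 ≤ Real.logb 2 (2 * 3 ^ d * m) / t :=
      div_nonneg (Real.logb_nonneg one_lt_two hKm) ht.le
    have h1 := Nat.le_ceil (Real.logb 2 (2 * 3 ^ d * m) / t)
    have h2 := Nat.ceil_lt_add_one hl0
    set n := ⌈Real.logb 2 (2 * 3 ^ d * m) / t⌉₊
    have hKm0 : (0 : ℝ) < 2 * 3 ^ d * m := one_pos.trans_le hKm
    have hpow : (2 : ℝ) ^ Real.logb 2 (2 * 3 ^ d * m) = 2 * 3 ^ d * m :=
      Real.rpow_logb two_pos (by norm_num) hKm0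
    refine coarseBound_le hd ν hsupp hr ht htα hm (rpow_le_Ncount ht hn0 hn) ?_ ?_ hq
    · rw [← hpow]
      refine Real.rpow_le_rpow_of_exponent_le one_le_two ?_
      rwa [div_le_iff₀' ht] at h1
    · calc (2 : ℝ) ^ (t * n) ≤ 2 ^ (Real.logb 2 (2 * 3 ^ d * m) + t) := by
            refine Real.rpow_le_rpow_of_exponent_le one_le_two ?_
            have h3 := mul_le_mul_of_nonneg_left h2.le ht.le
            rwa [mul_add, mul_div_cancel₀ _ ht.ne', mul_one] at h3
        _ = 2 * 3 ^ d * m * 2 ^ t := by rw [Real.rpow_add two_pos, hpow]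
        _ ≤ 2 * (2 * 3 ^ d * m * 2 ^ t) := by
            have : (0 : ℝ) ≤ 2 * 3 ^ d * m * 2 ^ t := by positivity
            linarith
        _ = _ := by ring
  refine le_of_forall_lt_imp_le_of_dense fun s hs => ?_
  refine le_liminf_of_le (isBoundedUnder_le_quantRatio hd ν hsupp hr).isCoboundedUnder_ge ?_
  filter_upwards [hf, (tendsto_coarseBound d ht htα).eventually_const_le hs] with m h1 h2
  exact h2.trans h1

lemma div_le_div_add_of_forall {r D F α : ℝ} (hr : 0 < r) (hD : 0 ≤ D) (hα : 0 < α)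
    (hFα : F ≤ α) (h : ∀ t, 0 < t → t < F → r * t / (α - t) ≤ D) : F / α ≤ D / (r + D) := by
  rw [div_le_iff₀ hα]
  refine le_of_forall_lt_imp_le_of_dense fun t ht => ?_
  rcases le_or_gt t 0 with ht0 | ht0
  · exact ht0.trans (by positivity)
  · have h1 := h t ht0 ht
    rw [div_le_iff₀ (by linarith)] at h1
    rw [div_mul_eq_mul_div, le_div_iff₀ (by positivity)]
    linarith

lemma FUpper_le_upperD_div {d : ℕ} (hd : 0 < d) (ν : Measure (Ed d)) [IsProbabilityMeasure ν]
    (hsupp : ν (Qcube d)ᶜ = 0) {r : ℝ} (hr : 0 < r) :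
    FUpper d ν r ≤ upperD d ν r / (r + upperD d ν r) := by
  refine csSup_le ⟨_, 1, one_pos, rfl⟩ ?_
  rintro v ⟨α, hα, rfl⟩
  exact div_le_div_add_of_forall hr
    ((lowerD_nonneg hd ν hsupp hr).trans (lowerD_le_upperD hd ν hsupp hr)) hα
    (FUpperAt_lt hd ν hr hα).le fun t ht htF => mul_div_sub_le_upperD hd ν hsupp hr hα ht htF

lemma FLower_le_lowerD_div {d : ℕ} (hd : 0 < d) (ν : Measure (Ed d)) [IsProbabilityMeasure ν]
    (hsupp : ν (Qcube d)ᶜ = 0) {r : ℝ} (hr : 0 < r) :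
    FLower d ν r ≤ lowerD d ν r / (r + lowerD d ν r) := by
  refine csSup_le ⟨_, 1, one_pos, rfl⟩ ?_
  rintro v ⟨α, hα, rfl⟩
  exact div_le_div_add_of_forall hr (lowerD_nonneg hd ν hsupp hr) hα
    ((FLowerAt_le_FUpperAt hd ν hr hα).trans (FUpperAt_lt hd ν hr hα).le)
    fun t ht htF => mul_div_sub_le_lowerD hd ν hsupp hr hα ht htF

/-- for `r > 0`, the chain
`rF̲_r/(1-F̲_r) ≤ D̲_r ≤ rh̲_r/(1-h̲_r) ≤ rh̄_r/(1-h̄_r) = D̄_r = rq_r/(1-q_r) = rF̄_r/(1-F̄_r)`. -/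
theorem quantization_dimension_chain_pos_order
    (d : ℕ) (hd : 0 < d) (ν : Measure (Ed d)) [IsProbabilityMeasure ν]
    (hsupp : ν (Qcube d)ᶜ = 0)
    (hbeta : ∃ q ∈ Set.Ioo (0:ℝ) 1, 0 < betaNu d ν q)
    (r : ℝ) (hr : 0 < r) :
    r * FLower d ν r / (1 - FLower d ν r) ≤ lowerD d ν r ∧
    lowerD d ν r ≤ r * hLowerLim d ν r / (1 - hLowerLim d ν r) ∧
    r * hLowerLim d ν r / (1 - hLowerLim d ν r) ≤ r * hUpper d ν r / (1 - hUpper d ν r) ∧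
    r * hUpper d ν r / (1 - hUpper d ν r) = upperD d ν r ∧
    upperD d ν r = r * qrCrit d ν r / (1 - qrCrit d ν r) ∧
    r * qrCrit d ν r / (1 - qrCrit d ν r) = r * FUpper d ν r / (1 - FUpper d ν r) := by
  have hL := lowerD_nonneg hd ν hsupp hr
  have hU := hL.trans (lowerD_le_upperD hd ν hsupp hr)
  have hψ : ∀ {D : ℝ}, 0 ≤ D → D / (r + D) < 1 := fun hD =>
    (div_lt_one (by positivity)).2 (by linarith)
  have h1 := upperD_div_le_hUpper hd ν hsupp hr
  have h2 := hUpper_le_qrCrit hd ν hsupp hr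
  have h3 := qrCrit_le_FUpper hd ν hsupp hr
  have h4 := FUpper_le_upperD_div hd ν hsupp hr
  have hFlt := FUpper_lt_one hd ν hr
  have hqF : qrCrit d ν r = FUpper d ν r := le_antisymm h3 (h4.trans (h1.trans h2))
  have hhF : hUpper d ν r = FUpper d ν r := le_antisymm (h2.trans h3) (h4.trans h1)
  have hFD : r * FUpper d ν r / (1 - FUpper d ν r) = upperD d ν r :=
    le_antisymm ((mul_div_one_sub_le_iff hr hU hFlt).2 h4)
      ((le_mul_div_one_sub_iff hr hU hFlt).2 (h1.trans hhF.le))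
  have hlim : hLowerLim d ν r ≤ FUpper d ν r := (hLowerLim_le_qrCrit hd ν hsupp hr).trans h3
  have h5 := FLower_le_lowerD_div hd ν hsupp hr
  rw [hqF, hhF, hFD]
  refine ⟨(mul_div_one_sub_le_iff hr hL (h5.trans_lt (hψ hL))).2 h5,
    (le_mul_div_one_sub_iff hr hL (hlim.trans_lt hFlt)).2
      ((lowerD_div_le_hLowerBase hd ν hsupp hr).trans (hLowerBase_le_hLowerLim hd ν hr)),
    ?_, rfl, rfl, rfl⟩
  rw [← hFD]
  exact mul_div_one_sub_mono hr hlim hFlt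
end
end

section
/- Let d ∈ ℕ, r ∈ (−d, 0), and set C_{r,d} := 2^{−r} + 18^d/(2^r − 2^{−d}). Then for every m ∈ ℕ and every finite set A ⊂ ℝ^d with 1 ≤ card(A) ≤ m, one has ∫_𝒬 d(x,A)^r dΛ(x) ≤ C_{r,d}·m^{−r/d}. -/
open MeasureTheory Filter Set Metric
open scoped ENNReal NNReal Topology Classical

noncomputable section

/-- The unit cube has volume one. -/
lemma volume_Qcube (d : ℕ) : volume (Qcube d) = 1 := by
  have h : Qcube d = Set.pi univ fun _ => Set.Ioc (0 : ℝ) 1 := by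
    ext x
    simp [Qcube]
  rw [h, Real.volume_pi_Ioc]
  simp

/-- The closed `t`-neighbourhood of a finite set is covered by cubes of side length `2 * t`. -/
lemma volume_infDist_le {d : ℕ} {A : Finset (Ed d)} (hA : A.Nonempty) {t : ℝ} (ht : 0 ≤ t) :
    volume {x | infDist x (A : Set (Ed d)) ≤ t} ≤ ENNReal.ofReal (A.card * (2 * t) ^ d) := by
  have hsub : {x | infDist x (A : Set (Ed d)) ≤ t} ⊆ ⋃ a ∈ A, closedBall a t := by
    intro x hx
    obtain ⟨a, ha, hxa⟩ := A.finite_toSet.isCompact.exists_infDist_eq_dist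
      (Finset.coe_nonempty.2 hA) x
    refine mem_iUnion₂.2 ⟨a, ha, ?_⟩
    rw [mem_closedBall, ← hxa]
    exact hx
  calc volume {x | infDist x (A : Set (Ed d)) ≤ t}
      ≤ ∑ a ∈ A, volume (closedBall a t) :=
        (measure_mono hsub).trans (measure_biUnion_finset_le _ _)
    _ = ENNReal.ofReal (A.card * (2 * t) ^ d) := by
        simp only [Real.volume_pi_closedBall _ ht, Fintype.card_fin, Finset.sum_const,
          nsmul_eq_mul]
        rw [ENNReal.ofReal_mul (by positivity), ENNReal.ofReal_natCast]

/-- Dyadic layer decomposition of the integral of a negative power. -/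
lemma lintegral_rpow_le_tsum {α : Type*} [MeasurableSpace α] {μ : Measure α} {f : α → ℝ}
    (hf : Measurable f) (hpos : ∀ᵐ x ∂μ, 0 < f x) {r t : ℝ} (hr : r ≤ 0) (ht : 0 < t) :
    ∫⁻ x, ENNReal.ofReal (f x) ^ r ∂μ ≤
      ENNReal.ofReal (t ^ r) * μ univ +
        ∑' k : ℕ, ENNReal.ofReal ((t * (1 / 2) ^ (k + 1)) ^ r) * μ {x | f x ≤ t * (1 / 2) ^ k} := by
  have hS : ∀ k : ℕ, MeasurableSet {x | f x ≤ t * (1 / 2) ^ k} := fun k =>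
    measurableSet_le hf measurable_const
  have hbound : ∀ᵐ x ∂μ, ENNReal.ofReal (f x) ^ r ≤ ENNReal.ofReal (t ^ r) +
      ∑' k : ℕ, {x | f x ≤ t * (1 / 2) ^ k}.indicator
        (fun _ => ENNReal.ofReal ((t * (1 / 2) ^ (k + 1)) ^ r)) x := by
    filter_upwards [hpos] with x hx
    rw [ENNReal.ofReal_rpow_of_pos hx]
    rcases le_total t (f x) with h | h
    · exact le_add_right (ENNReal.ofReal_le_ofReal (Real.rpow_le_rpow_of_nonpos ht h hr))
    · obtain ⟨k, hk, hk'⟩ := exists_nat_pow_near_of_lt_one (div_pos hx ht)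
        ((div_le_one ht).2 h) (by norm_num : (0 : ℝ) < 1 / 2) (by norm_num)
      rw [lt_div_iff₀' ht] at hk
      rw [div_le_iff₀' ht] at hk'
      refine le_add_left (le_trans ?_ (ENNReal.le_tsum k))
      rw [indicator_of_mem (by exact hk')]
      exact ENNReal.ofReal_le_ofReal
        (Real.rpow_le_rpow_of_nonpos (by positivity) hk.le hr)
  refine (lintegral_mono_ae hbound).trans_eq ?_
  rw [lintegral_add_left measurable_const, lintegral_const,
    lintegral_tsum fun k => (measurable_const.indicator (hS k)).aemeasurable]
  congr 2
  ext k
  rw [lintegral_indicator_const (hS k)]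

/-- for `r ∈ (-d,0)`, `C_{r,d} = 2^{-r} + 18^d/(2^r - 2^{-d})`, every `m ≥ 1`
and every set `A` with `1 ≤ card A ≤ m`, one has
`∫_𝒬 d(x,A)^r dΛ ≤ C_{r,d}·m^{-r/d}` (maximum norm). -/
theorem lintegral_infDist_rpow_le
    (d : ℕ) (hd : 0 < d) (r : ℝ) (hr : r ∈ Set.Ioo (-(d:ℝ)) 0)
    (m : ℕ) (hm : 1 ≤ m) (A : Finset (Ed d)) (hA : A.Nonempty) (hAm : A.card ≤ m) :
    (∫⁻ x in Qcube d, ENNReal.ofReal (infDist x (A : Set (Ed d))) ^ r) ≤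
      ENNReal.ofReal
        (((2:ℝ) ^ (-r) + (18:ℝ) ^ d / ((2:ℝ) ^ r - (2:ℝ) ^ (-(d:ℝ)))) *
          (m:ℝ) ^ (-r / (d:ℝ))) := by
  obtain ⟨hr1, hr2⟩ := hr
  have : Nonempty (Fin d) := ⟨⟨0, hd⟩⟩
  have hd' : (0 : ℝ) < d := by exact_mod_cast hd
  have hm' : (0 : ℝ) < m := by exact_mod_cast hm
  set s : ℝ := (m : ℝ) ^ (-1 / (d : ℝ)) with hs
  have hs0 : 0 < s := by positivity
  have hsr : s ^ r = (m : ℝ) ^ (-r / (d : ℝ)) := by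
    rw [hs, ← Real.rpow_mul hm'.le]
    congr 1
    ring
  have hsd : m * s ^ d = 1 := by
    rw [hs, ← Real.rpow_mul_natCast hm'.le, div_mul_cancel₀ _ hd'.ne', Real.rpow_neg_one,
      mul_inv_cancel₀ hm'.ne']
  set q : ℝ := (2 : ℝ) ^ (-(d + r)) with hq
  have hq0 : 0 < q := by positivity
  have hq1 : q < 1 := Real.rpow_lt_one_of_one_lt_of_neg (by norm_num) (by linarith)
  have hpos : ∀ᵐ x ∂volume.restrict (Qcube d), 0 < infDist x (A : Set (Ed d)) := by
    refine ae_restrict_of_ae ?_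
    have hA0 : volume (A : Set (Ed d)) = 0 := A.finite_toSet.measure_zero _
    filter_upwards [compl_mem_ae_iff.2 hA0] with x hx
    exact (A.finite_toSet.isClosed.notMem_iff_infDist_pos (Finset.coe_nonempty.2 hA)).1 hx
  have hterm (k : ℕ) : ENNReal.ofReal ((s / 2 * (1 / 2) ^ (k + 1)) ^ r) *
      (volume.restrict (Qcube d)) {x | infDist x (A : Set (Ed d)) ≤ s / 2 * (1 / 2) ^ k} ≤
      ENNReal.ofReal (s ^ r * 2 ^ (-2 * r) * q ^ k) := by
    refine (mul_le_mul_right ((Measure.restrict_apply_le _ _).trans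
      (volume_infDist_le hA (by positivity))) _).trans ?_
    rw [← ENNReal.ofReal_mul (by positivity)]
    refine ENNReal.ofReal_le_ofReal ?_
    have hcard : (A.card : ℝ) ≤ m := by exact_mod_cast hAm
    have hpow : (s / 2 * (1 / 2) ^ (k + 1)) ^ r = s ^ r * 2 ^ (-2 * r) * (2 : ℝ) ^ (-(k * r)) := by
      have h2 : s / 2 * (1 / 2) ^ (k + 1) = s * (2 : ℝ) ^ (-((k : ℝ) + 2)) := by
        rw [Real.rpow_neg (by norm_num), show (k : ℝ) + 2 = ((k + 2 : ℕ) : ℝ) by push_cast; ring,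
          Real.rpow_natCast, one_div, inv_pow]
        field_simp
        ring
      rw [h2, Real.mul_rpow hs0.le (by positivity),
        ← Real.rpow_mul (by norm_num : (0 : ℝ) ≤ 2), mul_assoc,
        ← Real.rpow_add (by norm_num)]
      congr 2
      ring
    have hqk : q ^ k = (2 : ℝ) ^ (-(k * r)) * ((1 / 2) ^ k) ^ d := by
      rw [hq, ← Real.rpow_mul_natCast (by norm_num), ← pow_mul, one_div, inv_pow,
        ← Real.rpow_natCast, ← Real.rpow_neg (by norm_num), ← Real.rpow_add (by norm_num)]
      congr 1
      push_cast
      ring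
    calc (s / 2 * (1 / 2) ^ (k + 1)) ^ r * (A.card * (2 * (s / 2 * (1 / 2) ^ k)) ^ d)
        ≤ (s / 2 * (1 / 2) ^ (k + 1)) ^ r * (m * (2 * (s / 2 * (1 / 2) ^ k)) ^ d) := by gcongr
      _ = (s / 2 * (1 / 2) ^ (k + 1)) ^ r * (m * s ^ d * ((1 / 2) ^ k) ^ d) := by
          rw [mul_assoc (m : ℝ), ← mul_pow]
          congr 3
          ring
      _ = s ^ r * 2 ^ (-2 * r) * q ^ k := by
          rw [hsd, hpow, hqk]
          ring
  have hdiff : (2 : ℝ) ^ r - 2 ^ (-(d : ℝ)) = 2 ^ r * (1 - q) := by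
    rw [mul_sub, mul_one, hq, ← Real.rpow_add (by norm_num)]
    congr 2
    ring
  have h18 : (2 : ℝ) ^ (-r) ≤ 18 ^ d := by
    calc (2 : ℝ) ^ (-r) ≤ 2 ^ (d : ℝ) :=
          Real.rpow_le_rpow_of_exponent_le (by norm_num) (by linarith)
      _ = 2 ^ d := Real.rpow_natCast _ _
      _ ≤ 18 ^ d := by gcongr; norm_num
  have hgeom : Summable fun k : ℕ => s ^ r * 2 ^ (-2 * r) * q ^ k :=
    (summable_geometric_of_lt_one hq0.le hq1).mul_left _
  refine (lintegral_rpow_le_tsum (continuous_infDist_pt _).measurable hpos hr2.le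
    (half_pos hs0)).trans ?_
  refine (add_le_add_right (ENNReal.tsum_le_tsum hterm) _).trans ?_
  rw [Measure.restrict_apply_univ, volume_Qcube, mul_one,
    ← ENNReal.ofReal_tsum_of_nonneg (fun k => by positivity) hgeom, tsum_mul_left,
    tsum_geometric_of_lt_one hq0.le hq1,
    ← ENNReal.ofReal_add (by positivity) (mul_nonneg (by positivity) (by simpa using hq1.le))]
  refine ENNReal.ofReal_le_ofReal ?_
  have h1q : 0 < 1 - q := sub_pos.2 hq1
  rw [← hsr, hdiff, Real.div_rpow hs0.le (by norm_num), div_eq_mul_inv (s ^ r),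
    ← Real.rpow_neg (by norm_num), add_mul, mul_comm (s ^ r) (2 ^ (-r))]
  refine add_le_add_right ?_ _
  calc s ^ r * 2 ^ (-2 * r) * (1 - q)⁻¹ = 2 ^ (-r) / (2 ^ r * (1 - q)) * s ^ r := by
        rw [show -2 * r = -r + -r by ring, Real.rpow_add (by norm_num),
          Real.rpow_neg (by norm_num)]
        field_simp
    _ ≤ 18 ^ d / (2 ^ r * (1 - q)) * s ^ r := by gcongr
end
end
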